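/- arXiv:0708.1174 — 3 statements merged into one kernel-verified Lean document; each statement's English description precedes it below -/
import Mathlib

section
/- Let n ≥ 3 and let A, B ∈ S^△. Then 𝔉(A) = 𝔉(B) if and only if for every set V of extreme points of S^△ one has A ∈ conv(V) ⟺ B ∈ conv(V). (Equivalently: two points of S^△ lie in the relative interior of the same face of the rotation complex for the Birkhoff polytope inside the bipartite matching polytope exactly when they are convex combinations of the same sets of vertices of S^△.) -/
open Finset

noncomputable section

/-- The inner product `A • X = Σ_{k,l} A_{k,l} X_{k,l}` on the matrix space. -/
def mdot {n : ℕ} (A X : Matrix (Fin n) (Fin n) ℝ) : ℝ := ∑ k, ∑ l, A k l * X k l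

/-- The permutation matrix of `σ`. -/
def permMat {n : ℕ} (σ : Equiv.Perm (Fin n)) : Matrix (Fin n) (Fin n) ℝ :=
  fun k l => if σ k = l then 1 else 0

/-- The Birkhoff polytope `S`: the convex hull of the permutation matrices. -/
def birkhoff (n : ℕ) : Set (Matrix (Fin n) (Fin n) ℝ) :=
  convexHull ℝ {X | ∃ σ : Equiv.Perm (Fin n), X = permMat σ}

/-- The bipartite matching polytope `P`: the convex hull of the 0/1 matrices with
all row and column sums at most 1. -/
def matchP (n : ℕ) : Set (Matrix (Fin n) (Fin n) ℝ) :=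
  convexHull ℝ {X | (∀ k l, X k l = 0 ∨ X k l = 1) ∧
    (∀ k, ∑ l, X k l ≤ 1) ∧ (∀ l, ∑ k, X k l ≤ 1)}

/-- The barycenter `z` of the permutation matrices: all entries `1/n`. -/
def zmat (n : ℕ) : Matrix (Fin n) (Fin n) ℝ := fun _ _ => 1 / (n : ℝ)

/-- The matrix `Q^{k·}` with ones in row `k` and zeros elsewhere. -/
def rowOnes {n : ℕ} (k : Fin n) : Matrix (Fin n) (Fin n) ℝ :=
  fun k' _ => if k' = k then 1 else 0

/-- The matrix `Q^{·l}` with ones in column `l` and zeros elsewhere. -/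
def colOnes {n : ℕ} (l : Fin n) : Matrix (Fin n) (Fin n) ℝ :=
  fun _ l' => if l' = l then 1 else 0

/-- The space `L^⊥`, spanned by the matrices `Q^{k·}` and `Q^{·l}`. -/
def Lperp (n : ℕ) : Submodule ℝ (Matrix (Fin n) (Fin n) ℝ) :=
  Submodule.span ℝ (Set.range rowOnes ∪ Set.range colOnes)

/-- The polar `S^△` of the Birkhoff polytope, constructed in `L` with respect to `z`. -/
def SpolarBk (n : ℕ) : Set (Matrix (Fin n) (Fin n) ℝ) :=
  {A | (∀ k, ∑ l, A k l = 0) ∧ (∀ l, ∑ k, A k l = 0) ∧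
    ∀ X ∈ birkhoff n, mdot A X ≤ 1 + mdot A (zmat n)}

/-- The set `𝔉(A)` of faces of the matching polytope obtainable from `A` by rotation. -/
def rotFacesBk {n : ℕ} (A : Matrix (Fin n) (Fin n) ℝ) :
    Set (Set (Matrix (Fin n) (Fin n) ℝ)) :=
  { F | ∃ Q ∈ Lperp n,
      (∀ X ∈ matchP n, mdot (A + Q) X ≤ 1 + mdot (A + Q) (zmat n)) ∧
      F = {X ∈ matchP n | mdot (A + Q) X = 1 + mdot (A + Q) (zmat n)} }

/-! ### Basic computations -/

def Vm {n : ℕ} (p : Fin n × Fin n) : Matrix (Fin n) (Fin n) ℝ :=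
  fun i j => -(n : ℝ) * (if i = p.1 then (if j = p.2 then 1 else 0) else 0)
    + (if i = p.1 then 1 else 0) + (if j = p.2 then 1 else 0) - 1 / (n : ℝ)

/-- `A ∈ L`. -/
def InL {n : ℕ} (A : Matrix (Fin n) (Fin n) ℝ) : Prop :=
  (∀ k, ∑ l, A k l = 0) ∧ (∀ l, ∑ k, A k l = 0)

/-- `M` represents `A` as a convex combination of the matrices `Vm`. -/
def IsRep {n : ℕ} (A M : Matrix (Fin n) (Fin n) ℝ) : Prop :=
  (∀ k l, 0 ≤ M k l) ∧ (∃ u v : Fin n → ℝ, ∀ k l, A k l + M k l = u k + v l) ∧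
    ∑ k, ∑ l, M k l = n

lemma mem_Lperp_of {n : ℕ} (Q : Matrix (Fin n) (Fin n) ℝ) (u v : Fin n → ℝ)
    (h : ∀ k l, Q k l = u k + v l) : Q ∈ Lperp n := by
  have : Q = ∑ k, u k • rowOnes k + ∑ l, v l • colOnes l := by
    ext i j
    simp [h, Matrix.add_apply, Matrix.sum_apply, rowOnes, colOnes]
  rw [this]
  refine Submodule.add_mem _ (Submodule.sum_mem _ fun k _ => Submodule.smul_mem _ _ ?_)
    (Submodule.sum_mem _ fun k _ => Submodule.smul_mem _ _ ?_)
  · exact Submodule.subset_span (Or.inl ⟨k, rfl⟩)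
  · exact Submodule.subset_span (Or.inr ⟨k, rfl⟩)

lemma of_mem_Lperp {n : ℕ} (Q : Matrix (Fin n) (Fin n) ℝ) (hQ : Q ∈ Lperp n) :
    ∃ u v : Fin n → ℝ, ∀ k l, Q k l = u k + v l := by
  unfold Lperp at hQ
  induction hQ using Submodule.span_induction with
  | mem x hx =>
    rcases hx with ⟨k, rfl⟩ | ⟨k, rfl⟩
    · exact ⟨fun i => if i = k then 1 else 0, 0, by intros; simp [rowOnes]⟩
    · exact ⟨0, fun i => if i = k then 1 else 0, by intros; simp [colOnes]⟩
  | zero => exact ⟨0, 0, by simp⟩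
  | add x y _ _ hx hy =>
    obtain ⟨u, v, h⟩ := hx
    obtain ⟨u', v', h'⟩ := hy
    exact ⟨u + u', v + v', by intro k l; simp [h, h']; ring⟩
  | smul a x _ hx =>
    obtain ⟨u, v, h⟩ := hx
    exact ⟨a • u, a • v, by intro k l; simp [h]; ring⟩

lemma mdot_perm {n : ℕ} (A : Matrix (Fin n) (Fin n) ℝ) (σ : Equiv.Perm (Fin n)) :
    mdot A (permMat σ) = ∑ k, A k (σ k) := by
  simp [mdot, permMat]

lemma mdot_zmat {n : ℕ} (A : Matrix (Fin n) (Fin n) ℝ) :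
    mdot A (zmat n) = (∑ k, ∑ l, A k l) / n := by
  simp [mdot, zmat, div_eq_mul_inv, Finset.sum_mul]

lemma InL.mdot_zmat {n : ℕ} {A : Matrix (Fin n) (Fin n) ℝ} (h : InL A) :
    mdot A (zmat n) = 0 := by
  rw [_root_.mdot_zmat]; simp [h.1]

lemma mdot_add_smul {n : ℕ} (A X Y : Matrix (Fin n) (Fin n) ℝ) (a b : ℝ) :
    mdot A (a • X + b • Y) = a * mdot A X + b * mdot A Y := by
  simp only [mdot, Finset.mul_sum, ← Finset.sum_add_distrib]
  refine Finset.sum_congr rfl fun i _ => Finset.sum_congr rfl fun j _ => ?_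
  simp; ring

lemma birkhoff_le {n : ℕ} (A : Matrix (Fin n) (Fin n) ℝ) (c : ℝ)
    (h : ∀ σ : Equiv.Perm (Fin n), ∑ k, A k (σ k) ≤ c) :
    ∀ X ∈ birkhoff n, mdot A X ≤ c := by
  intro X hX
  have : birkhoff n ⊆ {X | mdot A X ≤ c} := by
    refine convexHull_min ?_ ?_
    · rintro _ ⟨σ, rfl⟩
      simpa [mdot_perm] using h σ
    · intro X hX Y hY a b ha hb hab
      simp only [Set.mem_ofPred_eq] at *
      rw [mdot_add_smul]
      have e : c = a * c + b * c := by rw [← add_mul, hab, one_mul]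
      rw [e]
      exact add_le_add (mul_le_mul_of_nonneg_left hX ha) (mul_le_mul_of_nonneg_left hY hb)
  exact this hX

lemma permMat_mem {n : ℕ} (σ : Equiv.Perm (Fin n)) : permMat σ ∈ birkhoff n :=
  subset_convexHull _ _ ⟨σ, rfl⟩

lemma mem_birkhoff {n : ℕ} (X : Matrix (Fin n) (Fin n) ℝ) (h0 : ∀ i j, 0 ≤ X i j)
    (h1 : ∀ i, ∑ j, X i j = 1) (h2 : ∀ j, ∑ i, X i j = 1) : X ∈ birkhoff n := by
  have h : X ∈ (doublyStochastic ℝ (Fin n) : Set _) := mem_doublyStochastic_iff_sum.2 ⟨h0, h1, h2⟩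
  rw [doublyStochastic_eq_convexHull_permMatrix] at h
  unfold birkhoff
  convert h using 2
  ext Y
  have : ∀ σ : Equiv.Perm (Fin n), permMat σ = σ.permMatrix ℝ := by
    intro σ
    ext i j
    simp [permMat, PEquiv.toMatrix_apply, eq_comm]
  constructor
  · rintro ⟨σ, rfl⟩; exact ⟨σ, (this σ).symm⟩
  · rintro ⟨σ, rfl⟩; exact ⟨σ, (this σ).symm⟩

lemma mem_Spolar_iff {n : ℕ} (A : Matrix (Fin n) (Fin n) ℝ) :
    A ∈ SpolarBk n ↔ InL A ∧ ∀ σ : Equiv.Perm (Fin n), ∑ k, A k (σ k) ≤ 1 := by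
  constructor
  · rintro ⟨h1, h2, h3⟩
    refine ⟨⟨h1, h2⟩, fun σ => ?_⟩
    have := h3 _ (permMat_mem σ)
    rwa [mdot_perm, InL.mdot_zmat ⟨h1, h2⟩, add_zero] at this
  · rintro ⟨h1, h2⟩
    refine ⟨h1.1, h1.2, fun X hX => ?_⟩
    rw [h1.mdot_zmat, add_zero]
    exact birkhoff_le A 1 h2 X hX

lemma sum_Vm_mul {n : ℕ} (p : Fin n × Fin n) (G : Matrix (Fin n) (Fin n) ℝ) :
    ∑ i, ∑ j, Vm p i j * G i j = -(n : ℝ) * G p.1 p.2 + ∑ j, G p.1 j + ∑ i, G i p.2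
      - (∑ i, ∑ j, G i j) / n := by
  simp only [Vm, sub_mul, add_mul, mul_assoc, Finset.sum_add_distrib, Finset.sum_sub_distrib]
  simp [ite_mul, Finset.mul_sum, div_eq_inv_mul]

lemma sum_mul_Vm {n : ℕ} (M : Matrix (Fin n) (Fin n) ℝ) (i j : Fin n) :
    ∑ k, ∑ l, M k l * Vm (k, l) i j = -(n : ℝ) * M i j + ∑ l, M i l + ∑ k, M k j
      - (∑ k, ∑ l, M k l) / n := by
  simp only [Vm, mul_sub, mul_add, Finset.sum_add_distrib, Finset.sum_sub_distrib]
  simp [div_eq_mul_inv, Finset.sum_mul, Finset.sum_ite_irrel, mul_comm (n : ℝ)]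

lemma Vm_InL {n : ℕ} (hn : 0 < n) (p : Fin n × Fin n) : InL (Vm p) := by
  have : (n : ℝ) ≠ 0 := by positivity
  constructor <;> intro k <;>
  simp [Vm, Finset.sum_add_distrib, Finset.sum_sub_distrib, this] <;> split_ifs <;> simp

lemma Vm_perm {n : ℕ} (hn : 0 < n) (p : Fin n × Fin n) (σ : Equiv.Perm (Fin n)) :
    ∑ k, Vm p k (σ k) = 1 - n * (if σ p.1 = p.2 then 1 else 0) := by
  have : (n : ℝ) ≠ 0 := by positivity
  have h2 : ∀ k, (σ k = p.2) = (k = σ.symm p.2) := by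
    intro k; rw [Equiv.eq_symm_apply]
  simp only [Vm, Finset.sum_add_distrib, Finset.sum_sub_distrib, ← Finset.mul_sum]
  simp only [h2, Finset.sum_ite_eq', Finset.mem_univ, if_true]
  simp [this]
  split_ifs <;> ring

lemma Vm_mem {n : ℕ} (hn : 0 < n) (p : Fin n × Fin n) : Vm p ∈ SpolarBk n := by
  rw [mem_Spolar_iff]
  refine ⟨Vm_InL hn p, fun σ => ?_⟩
  rw [Vm_perm hn]
  split_ifs <;> simp

lemma Spolar_convex (n : ℕ) : Convex ℝ (SpolarBk n) := by
  intro A hA B hB a b ha hb hab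
  rw [mem_Spolar_iff] at *
  refine ⟨⟨fun k => ?_, fun k => ?_⟩, fun σ => ?_⟩
  · simp [Finset.sum_add_distrib, ← Finset.mul_sum, hA.1.1, hB.1.1]
  · simp [Finset.sum_add_distrib, ← Finset.mul_sum, hA.1.2, hB.1.2]
  · simp [Finset.sum_add_distrib, ← Finset.mul_sum]
    nlinarith [mul_le_mul_of_nonneg_left (hA.2 σ) ha, mul_le_mul_of_nonneg_left (hB.2 σ) hb]

/-- Hahn–Banach plus Birkhoff. -/
lemma hull_aux {n : ℕ} (hn : 0 < n) (A : Fin n → Fin n → ℝ)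
    (h : Matrix.of A ∈ SpolarBk n) :
    A ∈ convexHull ℝ (Set.range fun (p : Fin n × Fin n) (i j : Fin n) => Vm p i j) := by
  by_contra hA
  have hn' : (0 : ℝ) < n := by positivity
  obtain ⟨f, α, h1, h2⟩ := geometric_hahn_banach_closed_point (convex_convexHull ℝ _)
    ((Set.finite_range _).isClosed_convexHull ℝ) hA
  let G : Matrix (Fin n) (Fin n) ℝ := fun i j => f (Pi.single i (Pi.single j 1))
  have hf : ∀ X : Fin n → Fin n → ℝ, f X = ∑ i, ∑ j, X i j * G i j := by
    intro X
    have : X = ∑ i, ∑ j, X i j • (Pi.single i (Pi.single j 1) : Fin n → Fin n → ℝ) := by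
      ext a b
      simp only [Finset.sum_apply, Pi.smul_apply, Pi.single_apply, smul_eq_mul]
      rw [Finset.sum_eq_single a, Finset.sum_eq_single b]
      · simp
      · intro c _ hc; simp [hc.symm]
      · simp
      · intro c _ hc; simp [hc.symm]
      · simp
    conv_lhs => rw [this]
    simp only [map_sum, map_smul, smul_eq_mul, G]
  have hV : ∀ p : Fin n × Fin n, f (fun i j => Vm p i j) < α := fun p => h1 _ (subset_convexHull _ _ ⟨p, rfl⟩)
  have hV' : ∀ k l, -(n : ℝ) * G k l + ∑ j, G k j + ∑ i, G i l
      - (∑ i, ∑ j, G i j) / n < α := by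
    intro k l
    have := hV (k, l)
    rw [hf, sum_Vm_mul] at this
    exact this
  rw [mem_Spolar_iff] at h
  obtain ⟨hL, hσ⟩ := h
  set r : Fin n → ℝ := fun k => ∑ j, G k j with hr
  set c : Fin n → ℝ := fun l => ∑ i, G i l with hc
  set t : ℝ := ∑ i, ∑ j, G i j with ht
  have hrt : ∑ k, r k = t := rfl
  have hct : ∑ l, c l = t := Finset.sum_comm
  let Y : Matrix (Fin n) (Fin n) ℝ := fun k l => G k l - r k / n - c l / n + t / n / n
  have hYr : ∀ k, ∑ l, Y k l = 0 := by
    intro k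
    simp only [Y, Finset.sum_add_distrib, Finset.sum_sub_distrib, ← Finset.sum_div, hct]
    simp
    change r k - _ - _ + _ = 0
    field_simp
    ring
  have hYc : ∀ l, ∑ k, Y k l = 0 := by
    intro l
    simp only [Y, Finset.sum_add_distrib, Finset.sum_sub_distrib, ← Finset.sum_div, hrt]
    simp
    change c l - _ - _ + _ = 0
    field_simp
    ring
  have hY : ∀ k l, -(n : ℝ) * Y k l < α := by
    intro k l
    have := hV' k l
    have e : -(n : ℝ) * Y k l = -(n : ℝ) * G k l + r k + c l - t / n := by
      simp only [Y]; field_simp; ring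
    rw [e]; exact this
  have hα : 0 < α := by
    let k : Fin n := ⟨0, hn⟩
    have : ∑ l, -(n : ℝ) * Y k l < ∑ l : Fin n, α :=
      Finset.sum_lt_sum_of_nonempty ⟨k, Finset.mem_univ _⟩ fun l _ => hY k l
    rw [← Finset.mul_sum, hYr] at this
    simp at this
    exact pos_of_mul_pos_right this hn'.le
  have hX : (fun k l => 1 / (n : ℝ) + Y k l / α : Matrix (Fin n) (Fin n) ℝ) ∈ birkhoff n := by
    apply mem_birkhoff
    · intro k l
      have := hY k l
      have e : 1 / (n : ℝ) + Y k l / α = (α + n * Y k l) / (n * α) := by field_simp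
      rw [e]
      apply div_nonneg
      · linarith
      · positivity
    · intro k
      simp [Finset.sum_add_distrib, ← Finset.sum_div, hYr, hn'.ne']
    · intro k
      simp [Finset.sum_add_distrib, ← Finset.sum_div, hYc, hn'.ne']
  have h3 := birkhoff_le (Matrix.of A) 1 hσ _ hX
  have h4 : mdot (Matrix.of A) (fun k l => 1 / (n : ℝ) + Y k l / α) = f A / α := by
    rw [hf]
    have z1 : ∀ a : Fin n → ℝ, ∑ i, ∑ j, A i j * a i = 0 := by
      intro a; simp only [← Finset.sum_mul]
      refine Finset.sum_eq_zero fun i _ => ?_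
      rw [show ∑ j, A i j = 0 from hL.1 i, zero_mul]
    have z2 : ∀ a : Fin n → ℝ, ∑ i, ∑ j, A i j * a j = 0 := by
      intro a; rw [Finset.sum_comm]; simp only [← Finset.sum_mul]
      refine Finset.sum_eq_zero fun i _ => ?_
      rw [show ∑ j, A j i = 0 from hL.2 i, zero_mul]
    have : ∀ i j, A i j * (1 / (n : ℝ) + Y i j / α) = A i j * G i j / α
        + A i j * (fun i => 1 / (n : ℝ) - r i / n / α + t / n / n / α) i
        + A i j * (fun j => - c j / n / α) j := by
      intro i j; simp only [Y]; ring
    simp only [mdot, Matrix.of_apply, this, Finset.sum_add_distrib]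
    rw [z1, z2]
    simp only [← Finset.sum_div, add_zero]
  rw [h4, div_le_one hα] at h3
  linarith

lemma Spolar_subset_hull {n : ℕ} (hn : 0 < n) (A : Matrix (Fin n) (Fin n) ℝ)
    (h : A ∈ SpolarBk n) : A ∈ convexHull ℝ (Set.range (Vm : Fin n × Fin n → _)) :=
  hull_aux hn A h

lemma Spolar_eq_hull {n : ℕ} (hn : 0 < n) :
    SpolarBk n = convexHull ℝ (Set.range (Vm : Fin n × Fin n → _)) := by
  refine Set.Subset.antisymm (Spolar_subset_hull hn) (convexHull_min ?_ (Spolar_convex n))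
  rintro _ ⟨p, rfl⟩
  exact Vm_mem hn p

/-- `A` has a representation supported in `T`. -/
def HasRep {n : ℕ} (A : Matrix (Fin n) (Fin n) ℝ) (T : Set (Fin n × Fin n)) : Prop :=
  ∃ M, IsRep A M ∧ ∀ k l, M k l ≠ 0 → (k, l) ∈ T

lemma rep_add {n : ℕ} {A B M N : Matrix (Fin n) (Fin n) ℝ} {a b : ℝ}
    (hM : IsRep A M) (hN : IsRep B N) (hab : a + b = 1)
    (h0 : ∀ k l, 0 ≤ a * M k l + b * N k l) : IsRep (a • A + b • B) (a • M + b • N) := by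
  obtain ⟨_, ⟨u, v, h2⟩, h3⟩ := hM
  obtain ⟨_, ⟨u', v', h2'⟩, h3'⟩ := hN
  refine ⟨fun k l => by simpa using h0 k l, ⟨a • u + b • u', a • v + b • v', fun k l => ?_⟩, ?_⟩
  · simp
    linear_combination a * h2 k l + b * h2' k l
  · simp [Finset.sum_add_distrib, ← Finset.mul_sum, h3, h3']
    rw [← add_mul, hab, one_mul]

lemma rep_eq {n : ℕ} (hn : 0 < n) {A M : Matrix (Fin n) (Fin n) ℝ} (hA : InL A)
    (hM : ∃ u v : Fin n → ℝ, ∀ k l, A k l + M k l = u k + v l) :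
    A = ∑ p : Fin n × Fin n, (M p.1 p.2 / n) • Vm p := by
  have hn' : (n : ℝ) ≠ 0 := by positivity
  obtain ⟨u, v, h⟩ := hM
  ext i j
  have e : (∑ p : Fin n × Fin n, (M p.1 p.2 / n) • Vm p) i j
      = (∑ k, ∑ l, M k l * Vm (k, l) i j) / n := by
    rw [Matrix.sum_apply, Fintype.sum_prod_type, Finset.sum_div]
    refine Finset.sum_congr rfl fun k _ => ?_
    rw [Finset.sum_div]
    refine Finset.sum_congr rfl fun l _ => ?_
    simp; ring
  have h' : ∀ k l, M k l = u k + v l - A k l := fun k l => by linarith [h k l]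
  rw [e, sum_mul_Vm]
  simp only [h', Finset.sum_add_distrib, Finset.sum_sub_distrib, hA.1, hA.2]
  simp [← Finset.mul_sum]
  field_simp
  ring

lemma hull_of_hasRep {n : ℕ} (hn : 0 < n) {A : Matrix (Fin n) (Fin n) ℝ} (hA : InL A)
    {T : Set (Fin n × Fin n)} (h : HasRep A T) : A ∈ convexHull ℝ (Vm '' T) := by
  have hn' : (n : ℝ) ≠ 0 := by positivity
  obtain ⟨M, hM, hT⟩ := h
  rw [rep_eq hn hA hM.2.1]
  have h1 : ∑ p : Fin n × Fin n, M p.1 p.2 / n = 1 := by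
    rw [Fintype.sum_prod_type]
    simp only [← Finset.sum_div]
    rw [hM.2.2, div_self hn']
  rw [← Finset.sum_filter_of_ne (p := fun p => M p.1 p.2 ≠ 0)]
  · rw [← Finset.sum_filter_of_ne (p := fun p => M p.1 p.2 ≠ 0)] at h1
    · refine (convex_convexHull ℝ _).sum_mem (fun p _ => ?_) h1 (fun p hp => ?_)
      · exact div_nonneg (hM.1 _ _) (Nat.cast_nonneg _)
      · exact subset_convexHull _ _ ⟨p, hT _ _ (Finset.mem_filter.1 hp).2, rfl⟩
    · intro p _ hp h0
      exact hp (by rw [h0, zero_div])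
  · intro p _ hp h0
    exact hp (by rw [h0, zero_div, zero_smul])

lemma hasRep_of_hull {n : ℕ} {A : Matrix (Fin n) (Fin n) ℝ}
    {T : Set (Fin n × Fin n)} (h : A ∈ convexHull ℝ (Vm '' T)) : HasRep A T := by
  have : convexHull ℝ (Vm '' T) ⊆ {A | HasRep A T} := by
    refine convexHull_min ?_ ?_
    · rintro _ ⟨p, hp, rfl⟩
      refine ⟨fun i j => n * (if i = p.1 then (if j = p.2 then 1 else 0) else 0),
        ⟨?_, ⟨fun i => if i = p.1 then 1 else 0, fun j => (if j = p.2 then 1 else 0) - 1 / n, ?_⟩,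
        ?_⟩, ?_⟩
      · intro k l
        positivity
      · intro k l
        simp only [Vm]; ring
      · simp
      · intro k l h
        have : k = p.1 ∧ l = p.2 := by
          by_contra hc
          apply h
          rcases not_and_or.1 hc with hc | hc <;> simp [hc]
        rw [this.1, this.2]; exact hp
    · rintro X ⟨M, hM, hMT⟩ Y ⟨N, hN, hNT⟩ a b ha hb hab
      refine ⟨a • M + b • N, rep_add hM hN hab fun k l =>
        add_nonneg (mul_nonneg ha (hM.1 k l)) (mul_nonneg hb (hN.1 k l)), fun k l h => ?_⟩
      by_cases h1 : M k l = 0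
      · by_cases h2 : N k l = 0
        · simp [h1, h2] at h
        · exact hNT _ _ h2
      · exact hMT _ _ h1
  exact this h

lemma rep_of_Spolar {n : ℕ} (hn : 0 < n) {A : Matrix (Fin n) (Fin n) ℝ} (hA : A ∈ SpolarBk n) :
    ∃ M, IsRep A M := by
  have := Spolar_subset_hull hn A hA
  rw [← Set.image_univ] at this
  obtain ⟨M, hM, _⟩ := hasRep_of_hull this
  exact ⟨M, hM⟩

lemma rep_sum_uv {n : ℕ} (_hn : 0 < n) {A M : Matrix (Fin n) (Fin n) ℝ} {u v : Fin n → ℝ}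
    (hA : InL A) (h : ∀ k l, A k l + M k l = u k + v l) :
    ∑ k, ∑ l, M k l = n * (∑ k, u k + ∑ l, v l) := by
  have h' : ∀ k l, M k l = u k + v l - A k l := fun k l => by linarith [h k l]
  simp only [h', Finset.sum_add_distrib, Finset.sum_sub_distrib, hA.1]
  simp [← Finset.mul_sum]
  ring

lemma exists_perm {n : ℕ} (hn : 3 ≤ n) (i j k l : Fin n) (h : ¬ (i = k ∧ j = l)) :
    ∃ σ : Equiv.Perm (Fin n), σ i = j ∧ σ k ≠ l := by
  by_cases h1 : i = k
  · subst h1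
    refine ⟨Equiv.swap i j, by simp, ?_⟩
    simpa using h
  · by_cases h2 : Equiv.swap i j k = l
    · have hlj : l ≠ j := by
        intro e
        have : Equiv.swap i j k = Equiv.swap i j i := by rw [h2, e]; simp
        exact h1 ((Equiv.injective _ this).symm)
      obtain ⟨m, hm⟩ : ∃ m, m ∉ ({l, j} : Finset (Fin n)) := by
        by_contra hc
        push Not at hc
        have h3 : (Finset.univ : Finset (Fin n)) ⊆ {l, j} := fun x _ => hc x
        have := Finset.card_le_card h3
        have h4 := Finset.card_le_two (a := l) (b := j)
        simp at this
        omega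
      simp only [Finset.mem_insert, Finset.mem_singleton, not_or] at hm
      refine ⟨(Equiv.swap i j).trans (Equiv.swap l m), ?_, ?_⟩
      · simp [Equiv.swap_apply_of_ne_of_ne hlj.symm (Ne.symm hm.2)]
      · simp [h2, hm.1]
    · exact ⟨Equiv.swap i j, by simp, h2⟩

lemma Vm_extreme {n : ℕ} (hn : 3 ≤ n) (p : Fin n × Fin n) :
    Vm p ∈ Set.extremePoints ℝ (SpolarBk n) := by
  have hn0 : 0 < n := by omega
  have hn' : (0 : ℝ) < n := by positivity
  rw [mem_extremePoints_iff_left]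
  refine ⟨Vm_mem hn0 p, ?_⟩
  rintro A hA B hB ⟨a, b, ha, hb, hab, he⟩
  obtain ⟨M, hM⟩ := rep_of_Spolar hn0 hA
  obtain ⟨hAL, hAσ⟩ := (mem_Spolar_iff A).1 hA
  obtain ⟨hBL, hBσ⟩ := (mem_Spolar_iff B).1 hB
  obtain ⟨u, v, huv⟩ := hM.2.1
  have hs := rep_sum_uv hn0 hAL huv
  rw [hM.2.2] at hs
  have hs1 : ∑ k, u k + ∑ l, v l = 1 := by
    have : (n : ℝ) * (∑ k, u k + ∑ l, v l - 1) = 0 := by linarith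
    rcases mul_eq_zero.1 this with h | h
    · exact absurd h hn'.ne'
    · linarith
  have key : ∀ k l, ¬ (k = p.1 ∧ l = p.2) → M k l = 0 := by
    intro k l hkl
    obtain ⟨σ, h1, h2⟩ := exists_perm hn k l p.1 p.2 hkl
    have e1 := Vm_perm hn0 p σ
    rw [if_neg h2, mul_zero, sub_zero, ← he] at e1
    simp [Finset.sum_add_distrib, ← Finset.mul_sum] at e1
    have e2 : ∑ k, A k (σ k) = 1 := by
      have := hAσ σ
      have := hBσ σ
      nlinarith
    have e3 : ∑ k, M k (σ k) = 0 := by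
      have h' : ∀ k, M k (σ k) = u k + v (σ k) - A k (σ k) :=
        fun k => by linarith [huv k (σ k)]
      simp only [h', Finset.sum_sub_distrib, Finset.sum_add_distrib, e2]
      rw [Equiv.sum_comp σ v, hs1, sub_self]
    have e4 := (Finset.sum_eq_zero_iff_of_nonneg (fun k _ => hM.1 k (σ k))).1 e3 k
      (Finset.mem_univ _)
    rwa [h1] at e4
  have hR : HasRep A {p} := ⟨M, hM, fun k l h => by
    by_contra hc
    apply h
    apply key
    rintro ⟨rfl, rfl⟩
    exact hc rfl⟩
  have := hull_of_hasRep hn0 hAL hR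
  simpa using this

lemma extreme_eq {n : ℕ} (hn : 3 ≤ n) :
    Set.extremePoints ℝ (SpolarBk n) = Set.range (Vm : Fin n × Fin n → _) := by
  apply Set.Subset.antisymm
  · rw [Spolar_eq_hull (by omega)]
    exact extremePoints_convexHull_subset
  · rintro _ ⟨p, rfl⟩
    exact Vm_extreme hn p

lemma cond_iff {n : ℕ} (hn : 3 ≤ n) (A B : Matrix (Fin n) (Fin n) ℝ)
    (hA : InL A) (hB : InL B) :
    (∀ V ⊆ Set.extremePoints ℝ (SpolarBk n), (A ∈ convexHull ℝ V ↔ B ∈ convexHull ℝ V)) ↔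
      ∀ T, HasRep A T ↔ HasRep B T := by
  have hn0 : 0 < n := by omega
  have e : ∀ {A : Matrix (Fin n) (Fin n) ℝ}, InL A → ∀ T, A ∈ convexHull ℝ (Vm '' T) ↔ HasRep A T :=
    fun h T => ⟨hasRep_of_hull, hull_of_hasRep hn0 h⟩
  rw [extreme_eq hn]
  constructor
  · intro h T
    rw [← e hA, ← e hB]
    exact h _ (Set.image_subset_range _ _)
  · intro h V hV
    obtain ⟨T, rfl⟩ := Set.subset_range_iff_exists_image_eq.1 hV
    rw [e hA, e hB]
    exact h T

/-- The support of a matrix. -/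
def msupp {n : ℕ} (M : Matrix (Fin n) (Fin n) ℝ) : Finset (Fin n × Fin n) :=
  Finset.univ.filter fun p => M p.1 p.2 ≠ 0

lemma mem_msupp {n : ℕ} {M : Matrix (Fin n) (Fin n) ℝ} {p : Fin n × Fin n} :
    p ∈ msupp M ↔ M p.1 p.2 ≠ 0 := by simp [msupp]

lemma minimal_supp {n : ℕ} (A : Matrix (Fin n) (Fin n) ℝ) (t : Fin n × Fin n) (m : ℕ) :
    ∀ M, IsRep A M → t ∈ msupp M → (msupp M).card ≤ m →
      ∃ T : Set (Fin n × Fin n), T ⊆ msupp M ∧ HasRep A T ∧ ¬ HasRep A (T \ {t}) := by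
  induction m with
  | zero =>
    intro M hM ht hc
    have : msupp M = ∅ := Finset.card_eq_zero.1 (Nat.le_zero.1 hc)
    rw [this] at ht
    exact absurd ht (Finset.notMem_empty _)
  | succ m ih =>
    intro M hM ht hc
    by_cases h : HasRep A ((msupp M : Set (Fin n × Fin n)) \ {t})
    · obtain ⟨N, hN, hNT⟩ := h
      have hNt : N t.1 t.2 = 0 := by
        by_contra hc
        exact (hNT _ _ hc).2 rfl
      have hMt : M t.1 t.2 ≠ 0 := mem_msupp.1 ht
      have hMt' : 0 < M t.1 t.2 := lt_of_le_of_ne (hM.1 _ _) hMt.symm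
      -- entries where `N` is larger
      let D : Finset (Fin n × Fin n) := Finset.univ.filter fun p => M p.1 p.2 < N p.1 p.2
      have hD : D.Nonempty := by
        by_contra hD
        have hle : ∀ p : Fin n × Fin n, N p.1 p.2 ≤ M p.1 p.2 := by
          intro p
          by_contra hp
          exact hD ⟨p, by simpa [D] using hp⟩
        have : ∑ p : Fin n × Fin n, N p.1 p.2 < ∑ p : Fin n × Fin n, M p.1 p.2 :=
          Finset.sum_lt_sum (fun p _ => hle p) ⟨t, Finset.mem_univ _, by rw [hNt]; exact hMt'⟩
        rw [Fintype.sum_prod_type, Fintype.sum_prod_type, hM.2.2, hN.2.2] at this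
        exact lt_irrefl _ this
      obtain ⟨e, heD, hemin⟩ := D.exists_min_image
        (fun p => M p.1 p.2 / (N p.1 p.2 - M p.1 p.2)) hD
      have he : M e.1 e.2 < N e.1 e.2 := by simpa [D] using heD
      have hNe : N e.1 e.2 ≠ 0 := ne_of_gt (lt_of_le_of_lt (hM.1 _ _) he)
      have heM : e ∈ msupp M := (hNT _ _ hNe).1
      set lam := M e.1 e.2 / (N e.1 e.2 - M e.1 e.2) with hlam
      have hlam0 : 0 ≤ lam := div_nonneg (hM.1 _ _) (by linarith)
      have hge : ∀ k l, 0 ≤ (1 + lam) * M k l + (-lam) * N k l := by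
        intro k l
        by_cases hkl : M k l < N k l
        · have h1 := hemin (k, l) (by simpa [D] using hkl)
          have h2 : 0 < N k l - M k l := by linarith
          change lam ≤ M k l / (N k l - M k l) at h1
          rw [le_div_iff₀ h2] at h1
          linarith
        · have := mul_nonneg hlam0 (sub_nonneg.2 (not_lt.1 hkl))
          have := hM.1 k l
          linarith
      have hR := rep_add hM hN (show (1 + lam) + (-lam) = 1 by ring) hge
      have hAA : (1 + lam) • A + (-lam) • A = A := by
        rw [← add_smul]; simp
      rw [hAA] at hR
      have hsub : msupp ((1 + lam) • M + (-lam) • N) ⊆ (msupp M).erase e := by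
        intro p hp
        rw [mem_msupp] at hp
        simp only [Matrix.add_apply, Matrix.smul_apply, smul_eq_mul] at hp
        rw [Finset.mem_erase]
        constructor
        · rintro rfl
          apply hp
          have h2 : N p.1 p.2 - M p.1 p.2 ≠ 0 := by linarith
          rw [hlam]
          field_simp
          ring
        · rw [mem_msupp]
          intro h0
          have : N p.1 p.2 = 0 := by
            by_contra hc
            exact mem_msupp.1 (hNT _ _ hc).1 h0
          apply hp
          rw [h0, this]; ring
      have hcard := Finset.card_le_card hsub
      rw [Finset.card_erase_of_mem heM] at hcard
      obtain ⟨T, hT1, hT2, hT3⟩ := ih _ hR (by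
        rw [mem_msupp]
        simp only [Matrix.add_apply, Matrix.smul_apply, smul_eq_mul, hNt]
        have : 0 < (1 + lam) * M t.1 t.2 := by positivity
        linarith) (by omega)
      refine ⟨T, fun p hp => ?_, hT2, hT3⟩
      exact Finset.mem_of_mem_erase (hsub (hT1 hp))
    · exact ⟨_, subset_rfl, ⟨M, hM, fun k l hkl => mem_msupp.2 hkl⟩, h⟩

lemma rep_convex {n : ℕ} (B : Matrix (Fin n) (Fin n) ℝ) (T : Set (Fin n × Fin n)) :
    Convex ℝ {M | IsRep B M ∧ ∀ k l, M k l ≠ 0 → (k, l) ∈ T} := by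
  rintro M ⟨hM, hMT⟩ N ⟨hN, hNT⟩ a b ha hb hab
  constructor
  · have := rep_add hM hN hab fun k l =>
        add_nonneg (mul_nonneg ha (hM.1 k l)) (mul_nonneg hb (hN.1 k l))
    rwa [← add_smul, hab, one_smul] at this
  · intro k l h
    by_cases h1 : M k l = 0
    · by_cases h2 : N k l = 0
      · simp [h1, h2] at h
      · exact hNT _ _ h2
    · exact hMT _ _ h1

lemma exact_supp {n : ℕ} (hn : 0 < n) (A B : Matrix (Fin n) (Fin n) ℝ)
    (h : ∀ T, HasRep A T ↔ HasRep B T) (M : Matrix (Fin n) (Fin n) ℝ) (hM : IsRep A M) :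
    ∃ M', IsRep B M' ∧ ∀ k l, M' k l = 0 ↔ M k l = 0 := by
  have h1 : ∀ t : Fin n × Fin n, ∃ N, t ∈ msupp M →
      N ∈ {M' | IsRep B M' ∧ ∀ k l, M' k l ≠ 0 → (k, l) ∈ (msupp M : Set (Fin n × Fin n))} ∧
      N t.1 t.2 ≠ 0 := by
    intro t
    by_cases ht : t ∈ msupp M
    · obtain ⟨T, hT1, hT2, hT3⟩ := minimal_supp A t _ M hM ht le_rfl
      rw [h] at hT2 hT3
      obtain ⟨N, hN, hNT⟩ := hT2
      refine ⟨N, fun _ => ⟨⟨hN, fun k l hkl => hT1 (hNT k l hkl)⟩, fun h0 => hT3 ?_⟩⟩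
      refine ⟨N, hN, fun k l hkl => ⟨hNT k l hkl, ?_⟩⟩
      rintro rfl
      exact hkl h0
    · exact ⟨0, fun h => absurd h ht⟩
  choose N hN using h1
  have hne : (msupp M).Nonempty := by
    by_contra hc
    rw [Finset.not_nonempty_iff_eq_empty] at hc
    have : ∀ k l, M k l = 0 := by
      intro k l
      by_contra h0
      have := (mem_msupp (p := (k, l))).2 h0
      rw [hc] at this
      exact absurd this (Finset.notMem_empty _)
    have h2 := hM.2.2
    simp only [this, Finset.sum_const_zero] at h2
    have : (0 : ℝ) < n := by positivity
    linarith
  have hcpos : (0 : ℝ) < (msupp M).card := by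
    exact_mod_cast Finset.card_pos.2 hne
  have hmem := (rep_convex B (msupp M : Set (Fin n × Fin n))).sum_mem
    (t := msupp M) (w := fun _ => 1 / ((msupp M).card : ℝ)) (z := N)
    (fun _ _ => by positivity) (by simp [hcpos.ne']) (fun t ht => (hN t ht).1)
  refine ⟨_, hmem.1, fun k l => ⟨fun h0 => ?_, fun h0 => ?_⟩⟩
  · by_contra hk
    have ht : (k, l) ∈ msupp M := mem_msupp.2 hk
    rw [Matrix.sum_apply] at h0
    rw [Finset.sum_eq_zero_iff_of_nonneg] at h0
    · have := h0 _ ht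
      simp only [Matrix.smul_apply, smul_eq_mul, mul_eq_zero] at this
      rcases this with h2 | h2
      · have : 0 < 1 / ((msupp M).card : ℝ) := by positivity
        linarith
      · exact (hN _ ht).2 h2
    · intro t ht
      have := (hN t ht).1.1.1 k l
      simp only [Matrix.smul_apply, smul_eq_mul]
      positivity
  · by_contra hk
    exact mem_msupp.1 (hmem.2 k l hk) h0

/-! ### Duality -/

lemma zmat_mem {n : ℕ} (hn : 0 < n) : zmat n ∈ birkhoff n := by
  have hn' : (n : ℝ) ≠ 0 := by positivity
  apply mem_birkhoff
  · intro i j; simp [zmat]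
  · intro i; simp [zmat, hn']
  · intro i; simp [zmat, hn']

lemma eq_zero_of_perm_le {n : ℕ} (hn : 0 < n) (A : Matrix (Fin n) (Fin n) ℝ) (hA : InL A)
    (h : ∀ σ : Equiv.Perm (Fin n), ∑ k, A k (σ k) ≤ 0) : A = 0 := by
  have hn' : (0 : ℝ) < n := by positivity
  -- a large constant
  obtain ⟨c, hc0, hc⟩ : ∃ c : ℝ, 0 < c ∧ ∀ k l, -A k l ≤ c := by
    refine ⟨1 + ∑ k, ∑ l, |A k l|, by positivity, fun k l => ?_⟩
    have h1 : |A k l| ≤ ∑ l, |A k l| :=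
      Finset.single_le_sum (f := fun l => |A k l|) (fun _ _ => abs_nonneg _) (Finset.mem_univ l)
    have h2 : ∑ l, |A k l| ≤ ∑ k, ∑ l, |A k l| :=
      Finset.single_le_sum (f := fun k => ∑ l, |A k l|)
        (fun _ _ => Finset.sum_nonneg fun _ _ => abs_nonneg _) (Finset.mem_univ k)
    have := neg_le_abs (A k l)
    linarith
  have hX : (fun k l => 1 / (n : ℝ) + A k l / (n * c) : Matrix (Fin n) (Fin n) ℝ) ∈ birkhoff n := by
    apply mem_birkhoff
    · intro k l
      have := hc k l
      have e : 1 / (n : ℝ) + A k l / (n * c) = (c + A k l) / (n * c) := by field_simp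
      rw [e]
      apply div_nonneg
      · linarith
      · positivity
    · intro k
      simp [Finset.sum_add_distrib, ← Finset.sum_div, hA.1, hn'.ne']
    · intro k
      simp [Finset.sum_add_distrib, ← Finset.sum_div, hA.2, hn'.ne']
  have h1 := birkhoff_le A 0 h _ hX
  have h2 : mdot A (fun k l => 1 / (n : ℝ) + A k l / (n * c)) =
      (∑ k, ∑ l, A k l * A k l) / (n * c) := by
    simp only [mdot, mul_add, Finset.sum_add_distrib, ← Finset.sum_mul, hA.1]
    simp [Finset.sum_div, mul_div_assoc]
  rw [h2] at h1
  have h3 : ∑ k, ∑ l, A k l * A k l ≤ 0 := by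
    by_contra hc'
    have : 0 < (∑ k, ∑ l, A k l * A k l) / (n * c) := div_pos (not_le.1 hc') (by positivity)
    linarith
  have h4 : ∑ k, ∑ l, A k l * A k l = 0 := le_antisymm h3
    (Finset.sum_nonneg fun _ _ => Finset.sum_nonneg fun _ _ => mul_self_nonneg _)
  ext k l
  have h5 := (Finset.sum_eq_zero_iff_of_nonneg (fun _ _ =>
    Finset.sum_nonneg fun _ _ => mul_self_nonneg _)).1 h4 k (Finset.mem_univ _)
  have h6 := (Finset.sum_eq_zero_iff_of_nonneg (fun _ _ => mul_self_nonneg _)).1 h5 l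
    (Finset.mem_univ _)
  simpa using h6

/-- Egerváry duality for permutation matrices. -/
lemma egervary {n : ℕ} (hn : 0 < n) (D : Matrix (Fin n) (Fin n) ℝ) (b : ℝ)
    (h : ∀ σ : Equiv.Perm (Fin n), ∑ k, D k (σ k) ≤ b) :
    ∃ u v : Fin n → ℝ, (∀ k l, D k l ≤ u k + v l) ∧ ∑ k, u k + ∑ l, v l = b := by
  have hn' : (0 : ℝ) < n := by positivity
  set r : Fin n → ℝ := fun k => ∑ j, D k j with hr
  set c : Fin n → ℝ := fun l => ∑ i, D i l with hc
  set t : ℝ := ∑ i, ∑ j, D i j with ht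
  have hrt : ∑ k, r k = t := rfl
  have hct : ∑ l, c l = t := Finset.sum_comm
  let p : Fin n → ℝ := fun k => r k / n - t / n / n
  let q : Fin n → ℝ := fun l => c l / n
  have hp : ∑ k, p k = 0 := by
    simp only [p, Finset.sum_sub_distrib, ← Finset.sum_div, hrt]
    simp
    field_simp
    ring
  have hq : ∑ l, q l = t / n := by
    simp only [q, ← Finset.sum_div, hct]
  let Y : Matrix (Fin n) (Fin n) ℝ := fun k l => D k l - p k - q l
  have hYL : InL Y := by
    constructor
    · intro k
      simp only [Y, Finset.sum_sub_distrib, hq]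
      simp
      change r k - _ - _ = 0
      simp only [p]
      field_simp
      ring
    · intro l
      simp only [Y, Finset.sum_sub_distrib, hp]
      simp
      change c l - _ = 0
      simp only [q]
      field_simp
      ring
  have hYσ : ∀ σ : Equiv.Perm (Fin n), ∑ k, Y k (σ k) ≤ b - t / n := by
    intro σ
    simp only [Y, Finset.sum_sub_distrib, hp]
    rw [Equiv.sum_comp σ q, hq]
    linarith [h σ]
  have hβ : 0 ≤ b - t / n := by
    have := birkhoff_le Y _ hYσ _ (zmat_mem hn)
    rwa [hYL.mdot_zmat] at this
  rcases hβ.eq_or_lt with hβ | hβ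
  · rw [← hβ] at hYσ
    have hY0 := eq_zero_of_perm_le hn Y hYL hYσ
    refine ⟨p, q, fun k l => ?_, ?_⟩
    · have : Y k l = 0 := by rw [hY0]; rfl
      simp only [Y] at this
      linarith
    · rw [hp, hq]; linarith
  · set β := b - t / n with hβd
    let Z : Matrix (Fin n) (Fin n) ℝ := fun k l => Y k l / β
    have hZL : InL Z := by
      constructor
      · intro k; simp only [Z, ← Finset.sum_div, hYL.1, zero_div]
      · intro k; simp only [Z, ← Finset.sum_div, hYL.2, zero_div]
    have hZ : Z ∈ SpolarBk n := by
      rw [mem_Spolar_iff]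
      refine ⟨hZL, fun σ => ?_⟩
      simp only [Z, ← Finset.sum_div]
      rw [div_le_one hβ]
      exact hYσ σ
    obtain ⟨M, hM0, ⟨u, v, huv⟩, hMn⟩ := rep_of_Spolar hn hZ
    have hs := rep_sum_uv hn hZL huv
    rw [hMn] at hs
    have hs1 : ∑ k, u k + ∑ l, v l = 1 := by
      have : (n : ℝ) * (∑ k, u k + ∑ l, v l - 1) = 0 := by linarith
      rcases mul_eq_zero.1 this with h | h
      · exact absurd h hn'.ne'
      · linarith
    refine ⟨fun k => β * u k + p k, fun l => β * v l + q l, fun k l => ?_, ?_⟩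
    · have h1 := huv k l
      have h2 : Z k l ≤ u k + v l := by linarith [hM0 k l]
      simp only [Z] at h2
      rw [div_le_iff₀ hβ] at h2
      simp only [Y] at h2
      linarith
    · simp only [Finset.sum_add_distrib, ← Finset.mul_sum, hp, hq]
      have : β * ∑ k, u k + 0 + (β * ∑ l, v l + t / n) = β * (∑ k, u k + ∑ l, v l) + t / n := by
        ring
      rw [this, hs1, hβd]; ring

/-- Duality for the matching polytope. -/
lemma match_duality {n : ℕ} (hn : 0 < n) (C : Matrix (Fin n) (Fin n) ℝ) (b : ℝ)
    (h : ∀ X ∈ matchP n, mdot C X ≤ b) :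
    ∃ u v : Fin n → ℝ, (∀ k, 0 ≤ u k) ∧ (∀ l, 0 ≤ v l) ∧ (∀ k l, C k l ≤ u k + v l) ∧
      ∑ k, u k + ∑ l, v l = b := by
  let D : Matrix (Fin n) (Fin n) ℝ := fun k l => max (C k l) 0
  have hD : ∀ σ : Equiv.Perm (Fin n), ∑ k, D k (σ k) ≤ b := by
    intro σ
    let X : Matrix (Fin n) (Fin n) ℝ := fun k l => if σ k = l ∧ 0 ≤ C k l then 1 else 0
    have hXle : ∀ k l, X k l ≤ permMat σ k l := by
      intro k l
      simp only [X, permMat]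
      split_ifs <;> simp_all
    have hX : X ∈ matchP n := by
      refine subset_convexHull _ _ ⟨fun k l => ?_, fun k => ?_, fun l => ?_⟩
      · simp only [X]; split_ifs <;> simp
      · refine (Finset.sum_le_sum fun l _ => hXle k l).trans ?_
        simp [permMat]
      · refine (Finset.sum_le_sum fun k _ => hXle k l).trans ?_
        have h2 : ∀ k, (σ k = l) = (k = σ.symm l) := by
          intro k; rw [Equiv.eq_symm_apply]
        simp only [permMat, h2, Finset.sum_ite_eq', Finset.mem_univ, if_true, le_refl]
    have h1 := h X hX
    refine le_of_eq_of_le ?_ h1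
    simp only [mdot, D, X]
    refine Finset.sum_congr rfl fun k _ => ?_
    rw [Finset.sum_eq_single (σ k)]
    · by_cases hk : 0 ≤ C k (σ k)
      · simp [hk]
      · simp [hk, le_of_lt (not_le.1 hk)]
    · intro l _ hl
      simp [Ne.symm hl]
    · simp
  obtain ⟨u, v, huv, hs⟩ := egervary hn D b hD
  have : Nonempty (Fin n) := ⟨⟨0, hn⟩⟩
  obtain ⟨k0, hk0⟩ := Finite.exists_min u
  refine ⟨fun k => u k - u k0, fun l => v l + u k0, fun k => sub_nonneg.2 (hk0 k), fun l => ?_,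
    fun k l => ?_, ?_⟩
  · have := (le_max_right (C k0 l) 0).trans (huv k0 l)
    linarith
  · have := (le_max_left (C k l) 0).trans (huv k l)
    linarith
  · simp [Finset.sum_add_distrib, Finset.sum_sub_distrib]
    linarith

/-! ### Faces -/

lemma matchP_props {n : ℕ} (X : Matrix (Fin n) (Fin n) ℝ) (hX : X ∈ matchP n) :
    (∀ k l, 0 ≤ X k l) ∧ (∀ k, ∑ l, X k l ≤ 1) ∧ (∀ l, ∑ k, X k l ≤ 1) := by
  have : matchP n ⊆ {X | (∀ k l, 0 ≤ X k l) ∧ (∀ k, ∑ l, X k l ≤ 1) ∧ (∀ l, ∑ k, X k l ≤ 1)} := by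
    refine convexHull_min ?_ ?_
    · rintro X ⟨h1, h2, h3⟩
      refine ⟨fun k l => ?_, h2, h3⟩
      rcases h1 k l with h | h <;> rw [h]
      exact zero_le_one
    · rintro X ⟨h1, h2, h3⟩ Y ⟨h1', h2', h3'⟩ a b ha hb hab
      refine ⟨fun k l => ?_, fun k => ?_, fun l => ?_⟩
      · exact add_nonneg (mul_nonneg ha (h1 k l)) (mul_nonneg hb (h1' k l))
      · simp [Finset.sum_add_distrib, ← Finset.mul_sum]
        nlinarith [mul_le_mul_of_nonneg_left (h2 k) ha, mul_le_mul_of_nonneg_left (h2' k) hb]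
      · simp [Finset.sum_add_distrib, ← Finset.mul_sum]
        nlinarith [mul_le_mul_of_nonneg_left (h3 l) ha, mul_le_mul_of_nonneg_left (h3' l) hb]
  exact this hX

lemma gap_eq {n : ℕ} (C M X : Matrix (Fin n) (Fin n) ℝ) (u v : Fin n → ℝ)
    (h : ∀ k l, C k l = u k + v l - M k l) :
    ∑ k, u k + ∑ l, v l - mdot C X = ∑ k, u k * (1 - ∑ l, X k l) + ∑ l, v l * (1 - ∑ k, X k l)
      + ∑ k, ∑ l, M k l * X k l := by
  simp only [mdot, h, sub_mul, add_mul, Finset.sum_add_distrib, Finset.sum_sub_distrib, mul_sub,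
    mul_one, Finset.mul_sum]
  rw [Finset.sum_comm (f := fun l k => v l * X k l)]
  ring

lemma gap_iff {n : ℕ} (C M X : Matrix (Fin n) (Fin n) ℝ) (u v : Fin n → ℝ)
    (h : ∀ k l, C k l = u k + v l - M k l) (hM : ∀ k l, 0 ≤ M k l) (hu : ∀ k, 0 ≤ u k)
    (hv : ∀ l, 0 ≤ v l) (hX : X ∈ matchP n) :
    mdot C X ≤ ∑ k, u k + ∑ l, v l ∧ (mdot C X = ∑ k, u k + ∑ l, v l ↔
      (∑ k, u k * (1 - ∑ l, X k l) + ∑ l, v l * (1 - ∑ k, X k l) = 0 ∧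
        ∀ k l, M k l = 0 ∨ X k l = 0)) := by
  obtain ⟨h1, h2, h3⟩ := matchP_props X hX
  have hg := gap_eq C M X u v h
  have g1 : 0 ≤ ∑ k, u k * (1 - ∑ l, X k l) :=
    Finset.sum_nonneg fun k _ => mul_nonneg (hu k) (sub_nonneg.2 (h2 k))
  have g2 : 0 ≤ ∑ l, v l * (1 - ∑ k, X k l) :=
    Finset.sum_nonneg fun k _ => mul_nonneg (hv k) (sub_nonneg.2 (h3 k))
  have g3 : 0 ≤ ∑ k, ∑ l, M k l * X k l :=
    Finset.sum_nonneg fun k _ => Finset.sum_nonneg fun l _ => mul_nonneg (hM k l) (h1 k l)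
  refine ⟨by linarith, fun he => ⟨by linarith, fun k l => ?_⟩, fun ⟨e1, e2⟩ => ?_⟩
  · have e : ∑ k, ∑ l, M k l * X k l = 0 := by linarith
    have h5 := (Finset.sum_eq_zero_iff_of_nonneg (fun k _ =>
      Finset.sum_nonneg fun l _ => mul_nonneg (hM k l) (h1 k l))).1 e k (Finset.mem_univ _)
    have h6 := (Finset.sum_eq_zero_iff_of_nonneg (fun l _ => mul_nonneg (hM k l) (h1 k l))).1 h5 l
      (Finset.mem_univ _)
    exact mul_eq_zero.1 h6
  · have e : ∑ k, ∑ l, M k l * X k l = 0 :=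
      Finset.sum_eq_zero fun k _ => Finset.sum_eq_zero fun l _ => mul_eq_zero.2 (e2 k l)
    linarith

lemma one_add_mdot {n : ℕ} (hn : 0 < n) (C M : Matrix (Fin n) (Fin n) ℝ) (u v : Fin n → ℝ)
    (h : ∀ k l, C k l = u k + v l - M k l) :
    1 + mdot C (zmat n) = ∑ k, u k + ∑ l, v l + (1 - (∑ k, ∑ l, M k l) / n) := by
  have hn' : (n : ℝ) ≠ 0 := by positivity
  rw [mdot_zmat]
  simp only [h, Finset.sum_add_distrib, Finset.sum_sub_distrib]
  simp [← Finset.mul_sum]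
  field_simp
  ring

lemma faces_subset {n : ℕ} (hn : 0 < n) (A B : Matrix (Fin n) (Fin n) ℝ)
    (h : ∀ T, HasRep A T ↔ HasRep B T) : rotFacesBk A ⊆ rotFacesBk B := by
  have hn' : (n : ℝ) ≠ 0 := by positivity
  rintro F ⟨Q, hQ, hv, rfl⟩
  obtain ⟨u, v, hu0, hv0, huv, hs⟩ := match_duality hn _ _ hv
  let M : Matrix (Fin n) (Fin n) ℝ := fun k l => u k + v l - (A + Q) k l
  have hM0 : ∀ k l, 0 ≤ M k l := fun k l => sub_nonneg.2 (huv k l)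
  have hC : ∀ k l, (A + Q) k l = u k + v l - M k l := fun k l => by simp [M]
  have e1 := one_add_mdot hn (A + Q) M u v hC
  have hMs : ∑ k, ∑ l, M k l = n := by
    have : (∑ k, ∑ l, M k l) / n = 1 := by linarith
    rwa [div_eq_one_iff_eq hn'] at this
  obtain ⟨x, y, hxy⟩ := of_mem_Lperp Q hQ
  have hR : IsRep A M := ⟨hM0, ⟨u - x, v - y, fun k l => by simp [M, hxy]; ring⟩, hMs⟩
  obtain ⟨M', hM', hsupp⟩ := exact_supp hn A B h M hR
  obtain ⟨x', y', hxy'⟩ := hM'.2.1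
  let Q' : Matrix (Fin n) (Fin n) ℝ := fun k l => u k + v l - M' k l - B k l
  have hC' : ∀ k l, (B + Q') k l = u k + v l - M' k l := fun k l => by
    change B k l + (u k + v l - M' k l - B k l) = _
    ring
  have e2 := one_add_mdot hn (B + Q') M' u v hC'
  rw [hM'.2.2, div_self hn', sub_self, add_zero] at e2
  refine ⟨Q', mem_Lperp_of _ (u - x') (v - y') fun k l => ?_, fun X hX => ?_, ?_⟩
  · have := hxy' k l
    simp [Q']
    linarith
  · rw [e2]
    exact (gap_iff _ M' X u v hC' hM'.1 hu0 hv0 hX).1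
  · rw [e2, ← hs]
    ext X
    refine and_congr_right fun hX => ?_
    rw [(gap_iff _ M' X u v hC' hM'.1 hu0 hv0 hX).2, (gap_iff _ M X u v hC hM0 hu0 hv0 hX).2]
    simp only [hsupp]

lemma matchP_of {n : ℕ} (X : Matrix (Fin n) (Fin n) ℝ) (h1 : ∀ k l, X k l = 0 ∨ X k l = 1)
    (h2 : ∀ k, ∑ l, X k l ≤ 1) (h3 : ∀ l, ∑ k, X k l ≤ 1) : X ∈ matchP n :=
  subset_convexHull _ _ ⟨h1, h2, h3⟩

lemma unit_mem {n : ℕ} (k l : Fin n) :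
    (fun i j => if i = k then (if j = l then 1 else 0) else 0 : Matrix (Fin n) (Fin n) ℝ)
      ∈ matchP n := by
  refine matchP_of _ (fun i j => ?_) (fun i => ?_) (fun j => ?_)
  · split_ifs <;> simp
  · by_cases h : i = k <;> simp [h]
  · by_cases h : j = l <;> simp [h]

lemma mdot_unit {n : ℕ} (C : Matrix (Fin n) (Fin n) ℝ) (k l : Fin n) :
    mdot C (fun i j => if i = k then (if j = l then 1 else 0) else 0) = C k l := by
  simp [mdot]

lemma zero_mem_matchP {n : ℕ} : (0 : Matrix (Fin n) (Fin n) ℝ) ∈ matchP n :=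
  subset_convexHull _ _ ⟨by simp, by simp, by simp⟩

lemma mdot_zero' {n : ℕ} (C : Matrix (Fin n) (Fin n) ℝ) : mdot C 0 = 0 := by
  simp [mdot]

lemma hasRep_transfer {n : ℕ} (hn : 0 < n) (A B : Matrix (Fin n) (Fin n) ℝ)
    (hA : InL A) (hB : InL B) (h : rotFacesBk A ⊆ rotFacesBk B) (T : Set (Fin n × Fin n))
    (hT : HasRep A T) : HasRep B T := by
  have hn' : (n : ℝ) ≠ 0 := by positivity
  obtain ⟨M, hM, hMT⟩ := hT
  obtain ⟨x, y, hxy⟩ := hM.2.1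
  let Q : Matrix (Fin n) (Fin n) ℝ := fun k l => - M k l - A k l
  have hC : ∀ k l, (A + Q) k l = (0 : Fin n → ℝ) k + (0 : Fin n → ℝ) l - M k l :=
    fun k l => by
      change A k l + (- M k l - A k l) = 0 + 0 - M k l
      ring
  have e1 := one_add_mdot hn (A + Q) M 0 0 hC
  rw [hM.2.2, div_self hn', sub_self, add_zero] at e1
  have hF : {X ∈ matchP n | mdot (A + Q) X = 1 + mdot (A + Q) (zmat n)} ∈ rotFacesBk A := by
    refine ⟨Q, mem_Lperp_of _ (-x) (-y) fun k l => ?_, fun X hX => ?_, rfl⟩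
    · have := hxy k l
      simp [Q]
      linarith
    · rw [e1]
      exact (gap_iff _ M X 0 0 hC hM.1 (fun _ => le_rfl) (fun _ => le_rfl) hX).1
  have e1' : 1 + mdot (A + Q) (zmat n) = 0 := by rw [e1]; simp
  rw [e1'] at hF
  obtain ⟨Q', hQ', hv, hFe⟩ := h hF
  have h0 : (0 : Matrix (Fin n) (Fin n) ℝ) ∈ {X ∈ matchP n | mdot (A + Q) X = 0} :=
    ⟨zero_mem_matchP, mdot_zero' _⟩
  rw [hFe] at h0
  have hb : 1 + mdot (B + Q') (zmat n) = 0 := by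
    have := h0.2
    rw [mdot_zero'] at this
    exact this.symm
  rw [hb] at hv hFe
  obtain ⟨x', y', hxy'⟩ := of_mem_Lperp Q' hQ'
  refine ⟨fun k l => -(B + Q') k l, ⟨fun k l => ?_, ⟨-x', -y', fun k l => ?_⟩, ?_⟩, fun k l hkl => ?_⟩
  · have := hv _ (unit_mem k l)
    rw [mdot_unit] at this
    linarith
  · simp [hxy']; ring
  · rw [mdot_zmat] at hb
    simp only [Finset.sum_neg_distrib]
    field_simp at hb
    linarith
  · apply hMT
    intro hM0
    have hm : (fun i j => if i = k then (if j = l then 1 else 0) else 0 :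
        Matrix (Fin n) (Fin n) ℝ) ∈ {X ∈ matchP n | mdot (A + Q) X = 0} := by
      refine ⟨unit_mem k l, ?_⟩
      rw [mdot_unit, hC, hM0]
      simp
    rw [hFe] at hm
    have := hm.2
    rw [mdot_unit] at this
    apply hkl
    change -((B + Q') k l) = 0
    rw [this, neg_zero]

theorem stmt2 {n : ℕ} (hn : 3 ≤ n) (A B : Matrix (Fin n) (Fin n) ℝ)
    (hA : A ∈ SpolarBk n) (hB : B ∈ SpolarBk n) :
    rotFacesBk A = rotFacesBk B ↔
      ∀ V ⊆ Set.extremePoints ℝ (SpolarBk n),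
        (A ∈ convexHull ℝ V ↔ B ∈ convexHull ℝ V) := by
  have hn0 : 0 < n := by omega
  have hAL := ((mem_Spolar_iff A).1 hA).1
  have hBL := ((mem_Spolar_iff B).1 hB).1
  rw [cond_iff hn A B hAL hBL]
  constructor
  · intro h T
    exact ⟨hasRep_transfer hn0 A B hAL hBL h.subset T,
      hasRep_transfer hn0 B A hBL hAL h.symm.subset T⟩
  · intro h
    exact Set.Subset.antisymm (faces_subset hn0 A B h) (faces_subset hn0 B A fun T => (h T).symm)

end
end

section
/- Let n ≥ 2 and let a, b ∈ S^△. Then 𝔉(a) = 𝔉(b) if and only if both of the following hold: (1) for all k, l ∈ [n], sign(a_k − a_l) = sign(b_k − b_l); and (2) for every permutation σ of [n] with a_{σ(1)} ≤ a_{σ(2)} ≤ … ≤ a_{σ(n)} and every r ∈ [n], sign((σ.w(r))·a − 1) = sign((σ.w(r))·b − 1). (This describes when two points lie in the relative interior of the same face of the rotation complex for the permutahedron Π^{n−1} as a facet of Π^{n}.) -/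
open Finset

noncomputable section

/-- The permutahedron `Π^{m-1} ⊂ ℝ^m`: the convex hull of the permutations of
`(1, 2, …, m)`. -/
def permutahedron (m : ℕ) : Set (Fin m → ℝ) :=
  convexHull ℝ {x | ∃ σ : Equiv.Perm (Fin m), x = fun j => ((σ⁻¹ j : Fin m) : ℝ) + 1}

/-- The polar `S^△` of `Π^{n-1}` with respect to its barycenter. -/
def SpolarPi (n : ℕ) : Set (Fin n → ℝ) :=
  {a | ∑ k, a k = 0 ∧ ∀ y ∈ permutahedron n, ∑ k, a k * y k ≤ 1}

/-- The set `𝔉(a)` of faces of `Π^n` obtainable from `a` by rotation. -/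
def rotFacesPi {n : ℕ} (a : Fin n → ℝ) : Set (Set (Fin (n + 1) → ℝ)) :=
  { F | ∃ μ : ℝ,
      (∀ x ∈ permutahedron (n + 1),
        (∑ k : Fin n, a k * x k.castSucc) + μ * x (Fin.last n) ≤ 1 + μ * (n + 1)) ∧
      F = {x ∈ permutahedron (n + 1) |
        (∑ k : Fin n, a k * x k.castSucc) + μ * x (Fin.last n) = 1 + μ * (n + 1)} }

/-- The vector `w(r)` (for `r ∈ [n]`, here `0`-indexed): entries `1, …, r-1`, then
`2r - n`, then `r+2, …, n+1`. -/
def wvec (n : ℕ) (r : Fin n) : Fin n → ℝ :=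
  fun j => if (j : ℕ) < (r : ℕ) then (j : ℝ) + 1
    else if j = r then 2 * ((r : ℝ) + 1) - n
    else (j : ℝ) + 2

/-- Vertices of the permutahedron. -/
def pvert {m : ℕ} (τ : Equiv.Perm (Fin m)) : Fin m → ℝ :=
  fun j => ((τ⁻¹ j : Fin m) : ℝ) + 1

/-- The affine functional in question, normalized so that the bound is `1`. -/
def Lf {n : ℕ} (a : Fin n → ℝ) (μ : ℝ) (x : Fin (n + 1) → ℝ) : ℝ :=
  (∑ k : Fin n, a k * x k.castSucc) + μ * (x (Fin.last n) - (n + 1))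

/-- Maximum of the functional over the permutahedron. -/
def gmax {n : ℕ} (a : Fin n → ℝ) (μ : ℝ) : ℝ :=
  (Finset.univ : Finset (Equiv.Perm (Fin (n + 1)))).sup' ⟨1, Finset.mem_univ _⟩
    (fun τ => Lf a μ (pvert τ))

/-- The extended coefficient vector. -/
def extv {n : ℕ} (a : Fin n → ℝ) (μ : ℝ) : Fin (n + 1) → ℝ :=
  Fin.snoc (α := fun _ => ℝ) a μ

lemma ext_castSucc {n : ℕ} (a : Fin n → ℝ) (μ : ℝ) (k : Fin n) : extv a μ k.castSucc = a k := by
  simp [extv]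

lemma ext_last {n : ℕ} (a : Fin n → ℝ) (μ : ℝ) : extv a μ (Fin.last n) = μ := by
  simp [extv]

lemma inv_aux {m : ℕ} (τ : Equiv.Perm (Fin m)) (i : Fin m) : τ (τ⁻¹ i) = i := by simp

lemma pvert_mem {m : ℕ} (τ : Equiv.Perm (Fin m)) : pvert τ ∈ permutahedron m :=
  subset_convexHull ℝ _ ⟨τ, rfl⟩

lemma Lf_comb {n : ℕ} (a : Fin n → ℝ) (μ : ℝ) (x y : Fin (n + 1) → ℝ) (s t : ℝ)
    (h : s + t = 1) : Lf a μ (s • x + t • y) = s * Lf a μ x + t * Lf a μ y := by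
  have ht : t = 1 - s := by linarith
  subst ht
  simp only [Lf, Pi.add_apply, Pi.smul_apply, smul_eq_mul, mul_add, Finset.sum_add_distrib,
    Finset.mul_sum]
  have e1 : ∀ k : Fin n, a k * (s * x k.castSucc) = s * (a k * x k.castSucc) := fun k => by ring
  have e2 : ∀ k : Fin n, a k * ((1 - s) * y k.castSucc) = (1 - s) * (a k * y k.castSucc) :=
    fun k => by ring
  simp only [e1, e2]
  ring

lemma perm_ind {m : ℕ} (S : Set (Fin m → ℝ)) (hS : Convex ℝ S) (h : ∀ τ, pvert τ ∈ S) :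
    permutahedron m ⊆ S := by
  apply convexHull_min _ hS
  rintro x ⟨τ, rfl⟩
  exact h τ

lemma Lf_vert_le {n : ℕ} (a : Fin n → ℝ) (μ : ℝ) (τ : Equiv.Perm (Fin (n + 1))) :
    Lf a μ (pvert τ) ≤ gmax a μ :=
  Finset.le_sup' (fun τ => Lf a μ (pvert τ)) (Finset.mem_univ τ)

lemma gmax_exists {n : ℕ} (a : Fin n → ℝ) (μ : ℝ) :
    ∃ τ : Equiv.Perm (Fin (n + 1)), gmax a μ = Lf a μ (pvert τ) := by
  obtain ⟨τ, -, h⟩ := Finset.exists_mem_eq_sup'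
    (⟨1, Finset.mem_univ _⟩ : (Finset.univ : Finset (Equiv.Perm (Fin (n + 1)))).Nonempty)
    (fun τ => Lf a μ (pvert τ))
  exact ⟨τ, h⟩

lemma Lf_le {n : ℕ} (a : Fin n → ℝ) (μ : ℝ) (x : Fin (n + 1) → ℝ)
    (hx : x ∈ permutahedron (n + 1)) : Lf a μ x ≤ gmax a μ := by
  have := perm_ind {x | Lf a μ x ≤ gmax a μ} (by
    intro x hx y hy s t hs ht hst
    simp only [Set.mem_ofPred_eq] at *
    rw [Lf_comb _ _ _ _ _ _ hst]
    have e : gmax a μ = s * gmax a μ + t * gmax a μ := by rw [← add_mul, hst, one_mul]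
    rw [e]
    gcongr) (fun τ => Lf_vert_le a μ τ)
  exact this hx

lemma Lf_vert {n : ℕ} (a : Fin n → ℝ) (μ : ℝ) (τ : Equiv.Perm (Fin (n + 1))) :
    Lf a μ (pvert τ) = ∑ i : Fin (n + 1), ((i : ℝ) + 1) * extv a μ (τ i) - μ * (n + 1) := by
  have : ∑ i : Fin (n + 1), ((i : ℝ) + 1) * extv a μ (τ i) = ∑ j, extv a μ j * pvert τ j := by
    rw [← Equiv.sum_comp τ (fun j => extv a μ j * pvert τ j)]
    apply Finset.sum_congr rfl
    intro i _
    simp [pvert, mul_comm]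
  rw [this, Fin.sum_univ_castSucc]
  simp only [ext_castSucc, ext_last, Lf]
  ring

lemma monovary_iff {m : ℕ} (c : Fin m → ℝ) :
    Monovary (fun i : Fin m => ((i : ℝ) + 1)) c ↔ Monotone c := by
  constructor
  · intro h i j hij
    by_contra hc
    push Not at hc
    have := h hc
    simp only [add_le_add_iff_right, Nat.cast_le, Fin.val_fin_le] at this
    have e : i = j := le_antisymm hij this
    subst e
    exact lt_irrefl _ hc
  · intro h i j hij
    have : i < j := by
      by_contra hc
      exact absurd (h (not_lt.mp hc)) (not_le.mpr hij)
    simp only [add_le_add_iff_right, Nat.cast_le, Fin.val_fin_le]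
    exact this.le

lemma sorts_le {n : ℕ} (a : Fin n → ℝ) (μ : ℝ) (τ ρ : Equiv.Perm (Fin (n + 1)))
    (h : Monotone (extv a μ ∘ τ)) : Lf a μ (pvert ρ) ≤ Lf a μ (pvert τ) := by
  have := ((monovary_iff _).2 h).sum_mul_comp_perm_le_sum_mul (σ := τ⁻¹ * ρ)
  simp only [Function.comp_apply, Equiv.Perm.mul_apply, inv_aux] at this
  rw [Lf_vert, Lf_vert]
  linarith

lemma sorts_eq_gmax {n : ℕ} (a : Fin n → ℝ) (μ : ℝ) (τ : Equiv.Perm (Fin (n + 1)))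
    (h : Monotone (extv a μ ∘ τ)) : Lf a μ (pvert τ) = gmax a μ := by
  obtain ⟨ρ, hρ⟩ := gmax_exists a μ
  apply le_antisymm (Lf_vert_le a μ τ)
  rw [hρ]
  exact sorts_le a μ τ ρ h

lemma sorts_iff {n : ℕ} (a : Fin n → ℝ) (μ : ℝ) (τ : Equiv.Perm (Fin (n + 1))) :
    Monotone (extv a μ ∘ τ) ↔ Lf a μ (pvert τ) = gmax a μ := by
  refine ⟨sorts_eq_gmax a μ τ, fun h => ?_⟩
  have h0 := Tuple.monotone_sort (extv a μ)
  have h1 := sorts_eq_gmax a μ _ h0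
  have := ((monovary_iff _).2 h0).sum_mul_comp_perm_eq_sum_mul_iff
    (σ := (Tuple.sort (extv a μ))⁻¹ * τ)
  simp only [Function.comp_apply, Equiv.Perm.mul_apply, inv_aux] at this
  have h2 := this.1 (by rw [Lf_vert] at h h1; linarith)
  have h3 := (monovary_iff _).1 h2
  convert h3 using 1
  funext i
  simp

/-- Same weak order. -/
def SameOrd {m : ℕ} (c d : Fin m → ℝ) : Prop := ∀ i j, c i < c j ↔ d i < d j

lemma SameOrd.symm {m : ℕ} {c d : Fin m → ℝ} (h : SameOrd c d) : SameOrd d c :=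
  fun i j => (h i j).symm

lemma SameOrd.sorts {m : ℕ} {c d : Fin m → ℝ} (h : SameOrd c d) (τ : Equiv.Perm (Fin m))
    (hc : Monotone (c ∘ τ)) : Monotone (d ∘ τ) := by
  intro i j hij
  by_contra hh
  exact absurd (hc hij) (not_le.mpr ((h _ _).2 (not_le.mp hh)))

lemma comp_swap {m : ℕ} (c : Fin m → ℝ) (k l : Fin m) (h : c k = c l) (i : Fin m) :
    c (Equiv.swap k l i) = c i := by
  rw [Equiv.swap_apply_def]
  split_ifs with h1 h2
  · rw [h1, h]
  · rw [h2, h]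
  · rfl

lemma sameOrd_aux {m : ℕ} {c d : Fin m → ℝ}
    (h : ∀ τ : Equiv.Perm (Fin m), Monotone (c ∘ τ) ↔ Monotone (d ∘ τ)) (k l : Fin m)
    (hkl : c k < c l) : d k < d l := by
  by_contra hc
  push Not at hc
  set τ := Tuple.sort c
  have h0 : Monotone (c ∘ τ) := Tuple.monotone_sort c
  have h1 := (h τ).1 h0
  have lt : τ⁻¹ k < τ⁻¹ l := by
    by_contra hh
    have := h0 (not_lt.mp hh)
    simp at this
    linarith
  have h2 := h1 lt.le
  simp only [Function.comp_apply, inv_aux] at h2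
  have e : d k = d l := le_antisymm h2 hc
  have h3 : Monotone (d ∘ (Equiv.swap k l * τ : Equiv.Perm (Fin m))) := by
    intro i j hij
    simp only [Function.comp_apply, Equiv.Perm.mul_apply, comp_swap d k l e]
    exact h1 hij
  have h4 := (h _).2 h3 lt.le
  simp at h4
  linarith

lemma sameOrd_of_sorts {m : ℕ} {c d : Fin m → ℝ}
    (h : ∀ τ : Equiv.Perm (Fin m), Monotone (c ∘ τ) ↔ Monotone (d ∘ τ)) : SameOrd c d :=
  fun k l => ⟨sameOrd_aux h k l, sameOrd_aux (fun τ => (h τ).symm) k l⟩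

lemma sameOrd_ext {n : ℕ} (a b : Fin n → ℝ) (μ ν : ℝ) :
    SameOrd (extv a μ) (extv b ν) ↔
      SameOrd a b ∧ (∀ k, a k < μ ↔ b k < ν) ∧ ∀ k, μ < a k ↔ ν < b k := by
  constructor
  · intro h
    refine ⟨fun k l => ?_, fun k => ?_, fun k => ?_⟩
    · simpa [ext_castSucc] using h k.castSucc l.castSucc
    · simpa [ext_castSucc, ext_last] using h k.castSucc (Fin.last n)
    · simpa [ext_castSucc, ext_last] using h (Fin.last n) k.castSucc
  · rintro ⟨h1, h2, h3⟩ i j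
    induction i using Fin.lastCases with
    | last =>
      induction j using Fin.lastCases with
      | last => simp
      | cast j => simpa [ext_castSucc, ext_last] using h3 j
    | cast i =>
      induction j using Fin.lastCases with
      | last => simpa [ext_castSucc, ext_last] using h2 i
      | cast j => simpa [ext_castSucc] using h1 i j

/-- The face. -/
def face {n : ℕ} (a : Fin n → ℝ) (μ : ℝ) : Set (Fin (n + 1) → ℝ) :=
  {x | x ∈ permutahedron (n + 1) ∧ Lf a μ x = 1}

lemma mem_rot {n : ℕ} (a : Fin n → ℝ) (F : Set (Fin (n + 1) → ℝ)) :
    F ∈ rotFacesPi a ↔ ∃ μ, gmax a μ ≤ 1 ∧ F = face a μ := by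
  unfold rotFacesPi
  simp only [Set.mem_ofPred_eq]
  apply exists_congr
  intro μ
  have e1 : ∀ x : Fin (n + 1) → ℝ, ((∑ k : Fin n, a k * x k.castSucc) + μ * x (Fin.last n) ≤
      1 + μ * (n + 1)) ↔ Lf a μ x ≤ 1 := by
    intro x
    unfold Lf
    constructor <;> intro h <;> linarith
  have e2 : ∀ x : Fin (n + 1) → ℝ, ((∑ k : Fin n, a k * x k.castSucc) + μ * x (Fin.last n) =
      1 + μ * (n + 1)) ↔ Lf a μ x = 1 := by
    intro x
    unfold Lf
    constructor <;> intro h <;> linarith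
  simp only [e1, e2]
  apply and_congr _ Iff.rfl
  constructor
  · intro h
    obtain ⟨τ, hτ⟩ := gmax_exists a μ
    rw [hτ]
    exact h _ (pvert_mem τ)
  · intro h x hx
    exact (Lf_le a μ x hx).trans h

lemma face_subset {n : ℕ} {a b : Fin n → ℝ} {μ ν : ℝ} (ha : gmax a μ = 1) (hb : gmax b ν = 1)
    (h : SameOrd (extv a μ) (extv b ν)) : face a μ ⊆ face b ν := by
  have key := perm_ind {x | Lf a μ x ≤ 1 ∧ (Lf a μ x = 1 → Lf b ν x = 1)} (by
    rw [convex_iff_forall_pos]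
    intro x hx y hy s t hs ht hst
    simp only [Set.mem_ofPred_eq] at *
    rw [Lf_comb _ _ _ _ _ _ hst, Lf_comb _ _ _ _ _ _ hst]
    obtain ⟨hx1, hx2⟩ := hx
    obtain ⟨hy1, hy2⟩ := hy
    have i1 : s * Lf a μ x ≤ s := by nlinarith
    have i2 : t * Lf a μ y ≤ t := by nlinarith
    refine ⟨by linarith, fun he => ?_⟩
    have j1 : s * Lf a μ x = s * 1 := by linarith
    have j2 : t * Lf a μ y = t * 1 := by linarith
    rw [hx2 (mul_left_cancel₀ hs.ne' j1), hy2 (mul_left_cancel₀ ht.ne' j2)]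
    linarith) (by
    intro τ
    refine ⟨ha ▸ Lf_vert_le a μ τ, fun he => ?_⟩
    have h1 := (sorts_iff a μ τ).2 (he.trans ha.symm)
    exact ((sorts_iff b ν τ).1 (h.sorts τ h1)).trans hb)
  intro x hx
  exact ⟨hx.1, (key hx.1).2 hx.2⟩

lemma face_eq {n : ℕ} {a b : Fin n → ℝ} {μ ν : ℝ} (ha : gmax a μ = 1) (hb : gmax b ν = 1)
    (h : SameOrd (extv a μ) (extv b ν)) : face a μ = face b ν :=
  (face_subset ha hb h).antisymm (face_subset hb ha h.symm)

lemma face_empty {n : ℕ} {a : Fin n → ℝ} {μ : ℝ} (ha : gmax a μ < 1) : face a μ = ∅ := by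
  ext x
  simp only [face, Set.mem_ofPred_eq, Set.mem_empty_iff_false, iff_false, not_and]
  intro hx h
  have := Lf_le a μ x hx
  linarith

lemma of_face_eq {n : ℕ} {a b : Fin n → ℝ} {μ ν : ℝ} (ha : gmax a μ = 1) (hb : gmax b ν ≤ 1)
    (h : face a μ = face b ν) : gmax b ν = 1 ∧ SameOrd (extv a μ) (extv b ν) := by
  have hb1 : gmax b ν = 1 := by
    rcases hb.lt_or_eq with h1 | h1
    · rw [face_empty h1] at h
      obtain ⟨τ, hτ⟩ := gmax_exists a μ
      have : pvert τ ∈ face a μ := ⟨pvert_mem τ, by rw [← hτ, ha]⟩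
      rw [h] at this
      exact this.elim
    · exact h1
  refine ⟨hb1, sameOrd_of_sorts fun τ => ?_⟩
  rw [sorts_iff, sorts_iff, ha, hb1]
  have := Set.ext_iff.1 h (pvert τ)
  simpa [face, pvert_mem] using this

lemma pvert_last_le {n : ℕ} (τ : Equiv.Perm (Fin (n + 1))) :
    pvert τ (Fin.last n) ≤ n + 1 := by
  have : ((τ⁻¹ (Fin.last n) : Fin (n + 1)) : ℕ) ≤ n := by omega
  simp only [pvert]
  have : (((τ⁻¹ (Fin.last n) : Fin (n + 1)) : ℕ) : ℝ) ≤ n := by exact_mod_cast this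
  linarith

lemma gmax_anti {n : ℕ} (a : Fin n → ℝ) : Antitone (gmax a) := by
  intro μ ν h
  obtain ⟨τ, hτ⟩ := gmax_exists a ν
  rw [hτ]
  refine le_trans ?_ (Lf_vert_le a μ τ)
  have := pvert_last_le τ
  unfold Lf
  nlinarith

lemma gmax_strict {n : ℕ} (a : Fin n → ℝ) {μ ν : ℝ} (h : μ < ν) (k : Fin n) (hk : ν ≤ a k) :
    gmax a ν < gmax a μ := by
  have main : ∀ τ : Equiv.Perm (Fin (n + 1)), gmax a ν = Lf a ν (pvert τ) →
      pvert τ (Fin.last n) < n + 1 → gmax a ν < gmax a μ := by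
    intro τ hτ hl
    rw [hτ]
    refine lt_of_lt_of_le ?_ (Lf_vert_le a μ τ)
    unfold Lf
    nlinarith
  obtain ⟨τ, hτ⟩ := gmax_exists a ν
  rcases (pvert_last_le τ).lt_or_eq with hl | hl
  · exact main τ hτ hl
  · have hs := (sorts_iff a ν τ).2 hτ.symm
    have e0 : τ⁻¹ (Fin.last n) = Fin.last n := by
      apply Fin.ext
      simp only [pvert, add_left_inj, Nat.cast_inj] at hl
      simpa using hl
    have h1 := hs (Fin.le_last (τ⁻¹ k.castSucc))
    have e1 : τ (Fin.last n) = Fin.last n := by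
      conv_lhs => rw [← e0]
      simp
    simp only [Function.comp_apply, inv_aux, e1, ext_castSucc, ext_last] at h1
    have e : extv a ν k.castSucc = extv a ν (Fin.last n) := by
      rw [ext_castSucc, ext_last]; linarith
    have h3 : Monotone (extv a ν ∘ (Equiv.swap k.castSucc (Fin.last n) * τ :
        Equiv.Perm (Fin (n + 1)))) := by
      intro i j hij
      simp only [Function.comp_apply, Equiv.Perm.mul_apply, comp_swap _ _ _ e]
      exact hs hij
    refine main _ ((sorts_iff a ν _).1 h3).symm ?_
    refine lt_of_le_of_ne (pvert_last_le _) ?_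
    intro hh
    simp only [pvert, add_left_inj, Nat.cast_inj, mul_inv_rev, Equiv.Perm.mul_apply,
      Equiv.swap_inv, Equiv.swap_apply_right] at hh
    have h5 : τ⁻¹ k.castSucc = Fin.last n := by
      apply Fin.ext
      simpa using hh
    have h6 : k.castSucc = Fin.last n := τ⁻¹.injective (h5.trans e0.symm)
    exact absurd h6 (Fin.castSucc_lt_last k).ne

/-- Insert the last element at position `p`. -/
def ins {n : ℕ} (p : Fin (n + 1)) (σ : Equiv.Perm (Fin n)) : Equiv.Perm (Fin (n + 1)) :=
  ((finSuccEquiv' p).trans (Equiv.optionCongr σ)).trans finSuccEquivLast.symm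

lemma ins_self {n : ℕ} (p : Fin (n + 1)) (σ : Equiv.Perm (Fin n)) : ins p σ p = Fin.last n := by
  simp [ins]

lemma ins_succAbove {n : ℕ} (p : Fin (n + 1)) (σ : Equiv.Perm (Fin n)) (j : Fin n) :
    ins p σ (p.succAbove j) = (σ j).castSucc := by
  simp [ins]

lemma Lf_ins {n : ℕ} (a : Fin n → ℝ) (μ : ℝ) (p : Fin (n + 1)) (σ : Equiv.Perm (Fin n)) :
    Lf a μ (pvert (ins p σ)) =
      ∑ j, (((p.succAbove j : Fin (n + 1)) : ℝ) + 1) * a (σ j) + μ * (p - n) := by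
  rw [Lf_vert, Fin.sum_univ_succAbove _ p]
  simp only [ins_self, ins_succAbove, ext_castSucc, ext_last]
  ring

lemma gmax_top {n : ℕ} (a : Fin n → ℝ) (μ : ℝ) (σ : Equiv.Perm (Fin n))
    (hσ : Monotone (a ∘ σ)) (hμ : ∀ k, a k ≤ μ) :
    gmax a μ = ∑ j : Fin n, ((j : ℝ) + 1) * a (σ j) := by
  have hs : Monotone (extv a μ ∘ ins (Fin.last n) σ) := by
    intro i j hij
    have f1 : ∀ i : Fin n, ins (Fin.last n) σ i.castSucc = (σ i).castSucc := by
      intro i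
      have := ins_succAbove (Fin.last n) σ i
      simpa using this
    induction j using Fin.lastCases with
    | last =>
      induction i using Fin.lastCases with
      | last => rfl
      | cast i => simpa [f1, ins_self, ext_castSucc, ext_last] using hμ _
    | cast j =>
      induction i using Fin.lastCases with
      | last => exact absurd hij (not_le.mpr (Fin.castSucc_lt_last j))
      | cast i =>
        simp only [Function.comp_apply, f1, ext_castSucc]
        exact hσ (by simpa using hij)
  rw [← (sorts_iff _ _ _).1 hs, Lf_ins]
  simp

lemma gmax_top_le {n : ℕ} (a : Fin n → ℝ) (ha : a ∈ SpolarPi n) (μ : ℝ)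
    (hμ : ∀ k, a k ≤ μ) : gmax a μ ≤ 1 := by
  rw [gmax_top a μ _ (Tuple.monotone_sort a) hμ]
  have := ha.2 _ (pvert_mem (Tuple.sort a))
  rw [← Equiv.sum_comp (Tuple.sort a)] at this
  simpa [pvert, mul_comm] using this

lemma gmax_top_eq {n : ℕ} (a : Fin n → ℝ) (μ ν : ℝ)
    (hμ : ∀ k, a k ≤ μ) (hν : ∀ k, a k ≤ ν) : gmax a μ = gmax a ν := by
  rw [gmax_top a μ _ (Tuple.monotone_sort a) hμ, gmax_top a ν _ (Tuple.monotone_sort a) hν]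

lemma gmax_w {n : ℕ} (a : Fin n → ℝ) (σ : Equiv.Perm (Fin n))
    (hσ : Monotone (a ∘ σ)) (r : Fin n) :
    ∑ j, wvec n r j * a (σ j) = gmax a (a (σ r)) := by
  have hpos : ∀ j : Fin n, (((r.succ).succAbove j : Fin (n + 1)) : ℕ) =
      if j ≤ r then (j : ℕ) else j + 1 := by
    intro j
    split_ifs with h
    · rw [Fin.succAbove_of_castSucc_lt _ _ (by rw [Fin.lt_def]; simp; omega)]
      simp
    · rw [Fin.succAbove_of_le_castSucc _ _ (by rw [Fin.le_def]; simp; omega)]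
      simp
  have hs : Monotone (extv a (a (σ r)) ∘ ins r.succ σ) := by
    have f : ∀ i : Fin (n + 1), ∃ j : Fin n, (extv a (a (σ r)) ∘ ins r.succ σ) i = a (σ j) ∧
        (j : ℕ) = if (i : ℕ) ≤ r then (i : ℕ) else i - 1 := by
      intro i
      induction i using Fin.succAboveCases r.succ with
      | x =>
        exact ⟨r, by simp [ins_self, ext_last], by simp⟩
      | p j =>
        refine ⟨j, by simp [ins_succAbove, ext_castSucc], ?_⟩
        rw [hpos]
        split_ifs <;> omega
    intro i i' h
    obtain ⟨j, h1, h2⟩ := f i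
    obtain ⟨j', h1', h2'⟩ := f i'
    rw [h1, h1']
    apply hσ
    rw [Fin.le_def] at h ⊢
    split_ifs at h2 h2' <;> omega
  rw [← (sorts_iff _ _ _).1 hs, Lf_ins]
  have e : a (σ r) * (((r.succ : Fin (n + 1)) : ℝ) - n) =
      ∑ j, (if j = r then ((r : ℝ) + 1 - n) else 0) * a (σ j) := by
    simp; ring
  rw [e, ← Finset.sum_add_distrib]
  apply Finset.sum_congr rfl
  intro j _
  rw [hpos, ← add_mul]
  congr 1
  unfold wvec
  rcases lt_trichotomy j r with h | h | h
  · have : (j : ℕ) < r := h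
    simp [this, h.le, h.ne]
  · subst h
    simp; ring
  · have : ¬ (j : ℕ) < r := by rw [Fin.lt_def] at h; omega
    simp [this, h.not_ge, h.ne']; ring

lemma gmax_cont {n : ℕ} (a : Fin n → ℝ) : Continuous (gmax a) := by
  unfold gmax
  apply Continuous.finset_sup'_apply
  intro τ _
  unfold Lf
  fun_prop

lemma exists_mu {n : ℕ} (a : Fin n → ℝ) (ha : a ∈ SpolarPi n) (k : Fin n)
    (hk : ∀ l, a l ≤ a k) : ∃ μ ≤ a k, gmax a μ = 1 := by
  have hn : 0 < n := k.pos
  have hn' : (1 : ℝ) ≤ n := by exact_mod_cast hn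
  set C := ∑ j : Fin n, ((((0 : Fin (n + 1)).succAbove j : Fin (n + 1)) : ℝ) + 1) * a j
  have hlow : ∀ μ, C - μ * n ≤ gmax a μ := by
    intro μ
    have := Lf_vert_le a μ (ins 0 1)
    rw [Lf_ins] at this
    simp only [Equiv.Perm.one_apply, Fin.val_zero, Nat.cast_zero] at this
    linarith
  set m := min (a k) (-(|1 - C|))
  have hm : 1 ≤ gmax a m := by
    refine le_trans ?_ (hlow m)
    have h1 : m ≤ -(|1 - C|) := min_le_right _ _
    have h2 := abs_nonneg (1 - C)
    have h3 := le_abs_self (1 - C)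
    nlinarith
  have := intermediate_value_Icc' (min_le_left (a k) (-(|1 - C|))) (gmax_cont a).continuousOn
  obtain ⟨μ, hμ, h⟩ := this ⟨gmax_top_le a ha _ hk, hm⟩
  exact ⟨μ, hμ.2, h⟩

lemma sign_eq_iff (x y : ℝ) : Real.sign x = Real.sign y ↔ ((x < 0 ↔ y < 0) ∧ (0 < x ↔ 0 < y)) := by
  rcases lt_trichotomy x 0 with hx | hx | hx <;> rcases lt_trichotomy y 0 with hy | hy | hy <;>
    simp [hx, hy, Real.sign_of_neg, Real.sign_of_pos, hx.le, hy.le, hx.not_gt, hy.not_gt] <;>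
    norm_num

lemma gmax_lt_iff {n : ℕ} (a : Fin n → ℝ) {μ ν : ℝ} (k : Fin n) (hμ : μ ≤ a k)
    (hν : ν ≤ a k) : gmax a μ < gmax a ν ↔ ν < μ := by
  constructor
  · intro h
    by_contra hc
    exact absurd (gmax_anti a (not_lt.mp hc)) (not_le.mpr h)
  · intro h
    exact gmax_strict a h k hμ

lemma gmax_inj {n : ℕ} (a : Fin n → ℝ) {μ ν : ℝ} (k : Fin n) (hμ : μ ≤ a k)
    (hν : ν ≤ a k) (h : gmax a μ = gmax a ν) : μ = ν := by
  rcases lt_trichotomy μ ν with h1 | h1 | h1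
  · have := gmax_strict a h1 k hν
    linarith
  · exact h1
  · have := gmax_strict a h1 k hμ
    linarith

lemma rot_subset {n : ℕ} {a b : Fin n → ℝ} {k : Fin n}
    (hka : ∀ l, a l ≤ a k) (hkb : ∀ l, b l ≤ b k) {μ ν : ℝ} (hμ : μ ≤ a k) (hν : ν ≤ b k)
    (ga : gmax a μ = 1) (gb : gmax b ν = 1) (h : SameOrd (extv a μ) (extv b ν)) :
    rotFacesPi a ⊆ rotFacesPi b := by
  intro F hF
  rw [mem_rot] at hF ⊢
  obtain ⟨μ', hμ', rfl⟩ := hF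
  have hh := (sameOrd_ext _ _ _ _).1 h
  rcases hμ'.lt_or_eq with h1 | h1
  · have h2 : gmax a (a k) < 1 := by
      rcases le_total (a k) μ' with h3 | h3
      · rwa [gmax_top_eq a (a k) μ' hka (fun l => (hka l).trans h3)]
      · exact (gmax_anti a h3).trans_lt h1
    have h3 : μ < a k := by
      rcases hμ.lt_or_eq with h4 | h4
      · exact h4
      · rw [← h4] at h2; linarith
    have h4 := (hh.2.2 k).1 h3
    have h5 := gmax_strict b h4 k le_rfl
    rw [gb] at h5
    exact ⟨b k, h5.le, by rw [face_empty h1, face_empty h5]⟩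
  · rcases le_or_gt μ' (a k) with h2 | h2
    · have : μ' = μ := gmax_inj a k h2 hμ (h1.trans ga.symm)
      subst this
      exact ⟨ν, gb.le, face_eq h1 gb h⟩
    · have h3 : gmax a (a k) = 1 := by
        rw [gmax_top_eq a (a k) μ' hka (fun l => (hka l).trans h2.le), h1]
      have h4 : μ = a k := gmax_inj a k hμ le_rfl (ga.trans h3.symm)
      have h5 : ν = b k := by
        apply le_antisymm hν
        by_contra hc
        have := (hh.2.2 k).2 (not_le.mp hc)
        linarith
      have h6 : gmax b (b k + 1) = 1 := by
        rw [gmax_top_eq b (b k + 1) (b k) (fun l => (hkb l).trans (by linarith)) hkb, ← h5, gb]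
      refine ⟨b k + 1, h6.le, face_eq h1 h6 ((sameOrd_ext _ _ _ _).2 ⟨hh.1, ?_, ?_⟩)⟩
      · intro l
        have := hka l
        have := hkb l
        constructor <;> intro <;> linarith
      · intro l
        have := hka l
        have := hkb l
        constructor <;> intro <;> linarith

lemma max_transfer {n : ℕ} {a b : Fin n → ℝ} (h : SameOrd a b) {k : Fin n}
    (hka : ∀ l, a l ≤ a k) : ∀ l, b l ≤ b k := by
  intro l
  by_contra hc
  have := (h k l).2 (not_le.mp hc)
  have := hka l
  linarith

lemma rot_eq_iff {n : ℕ} {a b : Fin n → ℝ} {k : Fin n} (hab : SameOrd a b)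
    (hka : ∀ l, a l ≤ a k) {μ ν : ℝ} (hμ : μ ≤ a k) (hν : ν ≤ b k)
    (ga : gmax a μ = 1) (gb : gmax b ν = 1) :
    rotFacesPi a = rotFacesPi b ↔ SameOrd (extv a μ) (extv b ν) := by
  have hkb := max_transfer hab hka
  constructor
  · intro h
    have h1 : face a μ ∈ rotFacesPi b := by
      rw [← h, mem_rot]
      exact ⟨μ, ga.le, rfl⟩
    rw [mem_rot] at h1
    obtain ⟨ν', h2, h3⟩ := h1
    obtain ⟨h4, h5⟩ := of_face_eq ga h2 h3
    have h6 : ν' ≤ b k := by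
      by_contra hc
      have := (((sameOrd_ext _ _ _ _).1 h5).2.1 k).2 (not_le.mp hc)
      linarith
    have : ν' = ν := gmax_inj b k h6 hν (h4.trans gb.symm)
    rwa [← this]
  · intro h
    exact (rot_subset hka hkb hμ hν ga gb h).antisymm (rot_subset hkb hka hν hμ gb ga h.symm)

lemma sameOrd_of_rot {n : ℕ} {a b : Fin n → ℝ} {μ : ℝ} (ga : gmax a μ = 1)
    (h : rotFacesPi a = rotFacesPi b) : SameOrd a b := by
  have h1 : face a μ ∈ rotFacesPi b := by
    rw [← h, mem_rot]
    exact ⟨μ, ga.le, rfl⟩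
  rw [mem_rot] at h1
  obtain ⟨ν', h2, h3⟩ := h1
  obtain ⟨h4, h5⟩ := of_face_eq ga h2 h3
  exact ((sameOrd_ext _ _ _ _).1 h5).1

lemma sameOrd_iff_sign {n : ℕ} (a b : Fin n → ℝ) :
    (∀ k l : Fin n, Real.sign (a k - a l) = Real.sign (b k - b l)) ↔ SameOrd a b := by
  simp only [sign_eq_iff, sub_neg, sub_pos]
  exact ⟨fun h k l => (h k l).1, fun h k l => ⟨h k l, h l k⟩⟩


theorem stmt3 {n : ℕ} (hn : 2 ≤ n) (a b : Fin n → ℝ)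
    (ha : a ∈ SpolarPi n) (hb : b ∈ SpolarPi n) :
    rotFacesPi a = rotFacesPi b ↔
      ((∀ k l : Fin n, Real.sign (a k - a l) = Real.sign (b k - b l)) ∧
       ∀ σ : Equiv.Perm (Fin n), (∀ i j : Fin n, i ≤ j → a (σ i) ≤ a (σ j)) →
         ∀ r : Fin n,
           Real.sign ((∑ j, wvec n r j * a (σ j)) - 1) =
             Real.sign ((∑ j, wvec n r j * b (σ j)) - 1)) := by
  have : Nonempty (Fin n) := ⟨⟨0, by omega⟩⟩
  obtain ⟨k, hka⟩ := Finite.exists_max a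
  obtain ⟨μ, hμ, ga⟩ := exists_mu a ha k hka
  rw [sameOrd_iff_sign]
  have key : SameOrd a b → (rotFacesPi a = rotFacesPi b ↔
      ∀ σ : Equiv.Perm (Fin n), (∀ i j : Fin n, i ≤ j → a (σ i) ≤ a (σ j)) →
         ∀ r : Fin n,
           Real.sign ((∑ j, wvec n r j * a (σ j)) - 1) =
             Real.sign ((∑ j, wvec n r j * b (σ j)) - 1)) := by
    intro hab
    have hkb := max_transfer hab hka
    obtain ⟨ν, hν, gb⟩ := exists_mu b hb k hkb
    rw [rot_eq_iff hab hka hμ hν ga gb, sameOrd_ext]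
    have q : ∀ σ : Equiv.Perm (Fin n), (∀ i j : Fin n, i ≤ j → a (σ i) ≤ a (σ j)) →
        ∀ r : Fin n,
           (Real.sign ((∑ j, wvec n r j * a (σ j)) - 1) =
             Real.sign ((∑ j, wvec n r j * b (σ j)) - 1) ↔
             (μ < a (σ r) ↔ ν < b (σ r)) ∧ (a (σ r) < μ ↔ b (σ r) < ν)) := by
      intro σ hσ r
      have sa : Monotone (a ∘ σ) := fun i j h => hσ i j h
      have sb : Monotone (b ∘ σ) := hab.sorts σ sa
      rw [gmax_w a σ sa, gmax_w b σ sb, sign_eq_iff, sub_neg, sub_neg, sub_pos, sub_pos]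
      rw [← gmax_lt_iff a k (hka (σ r)) hμ, ← gmax_lt_iff a k hμ (hka (σ r)),
        ← gmax_lt_iff b k (hkb (σ r)) hν, ← gmax_lt_iff b k hν (hkb (σ r)), ga, gb]
    constructor
    · rintro ⟨-, h1, h2⟩ σ hσ r
      exact (q σ hσ r).2 ⟨h2 _, h1 _⟩
    · intro h
      have hs : ∀ i j : Fin n, i ≤ j → a (Tuple.sort a i) ≤ a (Tuple.sort a j) :=
        fun i j hij => Tuple.monotone_sort a hij
      have h' : ∀ l, (μ < a l ↔ ν < b l) ∧ (a l < μ ↔ b l < ν) := by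
        intro l
        have := (q _ hs ((Tuple.sort a)⁻¹ l)).1 (h _ hs _)
        simpa using this
      exact ⟨hab, fun l => (h' l).2, fun l => (h' l).1⟩
  constructor
  · intro h
    have hab := sameOrd_of_rot ga h
    exact ⟨hab, (key hab).1 h⟩
  · rintro ⟨hab, h⟩
    exact (key hab).2 h


end
end

section
/- Let C ⊂ ℝ^d be a pointed polyhedral cone (the conic hull of a finite set of vectors, with C ∩ (−C) = {0}) whose linear span is all of ℝ^d. Let A be an affine subspace of ℝ^d with 0 ∉ A and A ∩ C ≠ ∅. Then there exists a face F of C (a nonempty closed convex extreme subset of C) with A ∩ F ≠ ∅ and 1 ≤ dim span(F) ≤ d − dim(A). Moreover, if b₀ ∈ C ∩ A lies in a face F₀ of C, then F can be chosen with F ⊆ F₀. -/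
open Pointwise

/-- A face of a convex cone `C`: a nonempty, closed, convex, extreme subset of `C`. -/
def IsConeFace {d : ℕ} (C F : Set (EuclideanSpace ℝ (Fin d))) : Prop :=
  F.Nonempty ∧ IsClosed F ∧ Convex ℝ F ∧ IsExtreme ℝ C F

/-- The finitely generated pointed cone is closed. -/
theorem cone_isClosed {d : ℕ} (V : Finset (EuclideanSpace ℝ (Fin d)))
    (C : Set (EuclideanSpace ℝ (Fin d)))
    (hC : C = {x | ∃ c : EuclideanSpace ℝ (Fin d) → ℝ,
      (∀ v, 0 ≤ c v) ∧ x = ∑ v ∈ V, c v • v})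
    (hpointed : C ∩ (-C) = {0}) : IsClosed C := by
  classical
  set W := V.erase 0 with hW
  let Φ : (W → ℝ) → EuclideanSpace ℝ (Fin d) := fun c => ∑ v : W, c v • (v : EuclideanSpace ℝ (Fin d))
  have hΦc : Continuous Φ := by fun_prop
  have hmemΦ : ∀ x, x ∈ C ↔ ∃ c : W → ℝ, (∀ v, 0 ≤ c v) ∧ x = Φ c := by
    intro x
    rw [hC]
    constructor
    · rintro ⟨c, hc, rfl⟩
      refine ⟨fun v => c v, fun v => hc v, ?_⟩
      have h1 : Φ (fun v => c v) = ∑ v ∈ W, c v • v :=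
        Finset.sum_coe_sort W (fun v => c v • v)
      rw [h1, hW, Finset.sum_erase]
      simp
    · rintro ⟨c, hc, rfl⟩
      refine ⟨fun v => if h : v ∈ W then c ⟨v, h⟩ else 0, ?_, ?_⟩
      · intro v
        dsimp only
        split_ifs
        · exact hc _
        · exact le_rfl
      · rw [← Finset.sum_erase V (a := 0) (by simp), ← hW,
          ← Finset.sum_coe_sort W]
        refine Finset.sum_congr rfl fun v _ => ?_
        simp
  have hsm : ∀ (r : ℝ) c, Φ (r • c) = r • Φ c := by
    intro r c
    simp [Φ, Finset.smul_sum, mul_smul]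
  have h0 : (0 : EuclideanSpace ℝ (Fin d)) ∉ Φ '' stdSimplex ℝ W := by
    rintro ⟨c, ⟨hc, hs⟩, h⟩
    obtain ⟨v, hv⟩ : ∃ v, 0 < c v := by
      by_contra! hn
      have : ∑ v, c v ≤ 0 := Finset.sum_nonpos fun v _ => hn v
      linarith
    have hvC : c v • (v : EuclideanSpace ℝ (Fin d)) ∈ C := by
      rw [hmemΦ]
      refine ⟨Pi.single v (c v), ?_, ?_⟩
      · intro w
        by_cases hw : w = v
        · subst hw; simpa using hv.le
        · simp [Pi.single_apply, hw]
      · simp [Φ, Pi.single_apply, ite_smul]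
    have hvC' : -(c v • (v : EuclideanSpace ℝ (Fin d))) ∈ C := by
      rw [hmemΦ]
      refine ⟨Function.update c v 0, ?_, ?_⟩
      · intro w
        by_cases hw : w = v
        · subst hw; simp
        · simpa [Function.update_apply, hw] using hc w
      · have e1 : Φ c = c v • (v : EuclideanSpace ℝ (Fin d)) + Φ (Function.update c v 0) := by
          simp only [Φ]
          rw [← Finset.add_sum_erase _ _ (Finset.mem_univ v),
            ← Finset.add_sum_erase (a := v) _ (fun w : W => Function.update c v 0 w • (w : EuclideanSpace ℝ (Fin d))) (Finset.mem_univ v)]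
          simp only [Function.update_self, zero_smul, zero_add]
          congr 1
          refine Finset.sum_congr rfl fun w hw => ?_
          rw [Function.update_of_ne (Finset.ne_of_mem_erase hw)]
        rw [h] at e1
        exact neg_eq_of_add_eq_zero_right e1.symm
    have : c v • (v : EuclideanSpace ℝ (Fin d)) ∈ C ∩ (-C) := ⟨hvC, hvC'⟩
    rw [hpointed] at this
    have hz : (v : EuclideanSpace ℝ (Fin d)) = 0 := by
      rcases smul_eq_zero.1 (Set.mem_singleton_iff.1 this) with h | h
      · exact absurd h hv.ne'
      · exact h
    exact Finset.ne_of_mem_erase v.2 hz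
  have hcl : IsClosed (Φ '' stdSimplex ℝ W) := ((isCompact_stdSimplex ℝ W).image hΦc).isClosed
  obtain ⟨m, hm, hball⟩ := Metric.isOpen_iff.1 hcl.isOpen_compl 0 h0
  have hbound : ∀ c : W → ℝ, (∀ v, 0 ≤ c v) → m * ∑ v, c v ≤ ‖Φ c‖ := by
    intro c hc
    by_contra! hlt
    have hs0 : 0 ≤ ∑ v, c v := Finset.sum_nonneg fun v _ => hc v
    have hs : 0 < ∑ v, c v := by
      rcases hs0.eq_or_lt with h | h
      · rw [← h, mul_zero] at hlt
        exact absurd hlt (not_lt.2 (norm_nonneg _))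
      · exact h
    refine hball (a := Φ ((∑ v, c v)⁻¹ • c)) ?_ ⟨_, ⟨?_, ?_⟩, rfl⟩
    · rw [mem_ball_zero_iff, hsm, norm_smul, norm_inv, Real.norm_of_nonneg hs0,
        inv_mul_lt_iff₀ hs]
      linarith
    · intro v
      exact mul_nonneg (inv_nonneg.2 hs0) (hc v)
    · simp only [Pi.smul_apply, smul_eq_mul, ← Finset.mul_sum]
      exact inv_mul_cancel₀ hs.ne'
  refine isClosed_of_closure_subset fun x hx => ?_
  set R := (‖x‖ + 1) / m
  have hK : IsCompact (Φ '' Set.Icc (0 : W → ℝ) (fun _ => R)) := isCompact_Icc.image hΦc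
  have hsub : C ∩ Metric.ball x 1 ⊆ Φ '' Set.Icc (0 : W → ℝ) (fun _ => R) := by
    rintro y ⟨hy, hyb⟩
    obtain ⟨c, hc, rfl⟩ := (hmemΦ y).1 hy
    refine ⟨c, ⟨hc, fun v => ?_⟩, rfl⟩
    have h1 : c v ≤ ∑ v, c v := Finset.single_le_sum (fun v _ => hc v) (Finset.mem_univ v)
    have h2 := hbound c hc
    have h3 : ‖Φ c‖ ≤ ‖x‖ + 1 := by
      have := norm_le_norm_add_norm_sub' (Φ c) x
      rw [Metric.mem_ball, dist_eq_norm] at hyb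
      linarith
    have : c v ≤ R := by
      rw [le_div_iff₀ hm]
      nlinarith
    exact this
  have hx2 : x ∈ closure (C ∩ Metric.ball x 1) :=
    Set.inter_comm C _ ▸ Metric.isOpen_ball.inter_closure ⟨Metric.mem_ball_self one_pos, hx⟩
  obtain ⟨c, hc, rfl⟩ := hK.isClosed.closure_subset_iff.2 hsub hx2
  exact (hmemΦ _).2 ⟨c, hc.1, rfl⟩

/-- The minimal face of the cone `C` containing `b`. -/
def minFace {d : ℕ} (C : Set (EuclideanSpace ℝ (Fin d))) (b : EuclideanSpace ℝ (Fin d)) :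
    Set (EuclideanSpace ℝ (Fin d)) :=
  {x | x ∈ C ∧ ∃ t : ℝ, 0 < t ∧ b - t • x ∈ C}

section
variable {d : ℕ} {C : Set (EuclideanSpace ℝ (Fin d))}

theorem minFace_shrink {b x : EuclideanSpace ℝ (Fin d)}
    (hadd : ∀ x ∈ C, ∀ y ∈ C, x + y ∈ C) (hsmul : ∀ x ∈ C, ∀ r : ℝ, 0 ≤ r → r • x ∈ C)
    (hx : x ∈ C) {t s : ℝ} (h : b - t • x ∈ C) (hst : s ≤ t) : b - s • x ∈ C := by
  have := hadd _ h _ (hsmul x hx (t - s) (by linarith))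
  convert this using 1
  module

theorem minFace_add {b x y : EuclideanSpace ℝ (Fin d)}
    (hadd : ∀ x ∈ C, ∀ y ∈ C, x + y ∈ C) (hsmul : ∀ x ∈ C, ∀ r : ℝ, 0 ≤ r → r • x ∈ C)
    (hx : x ∈ minFace C b) (hy : y ∈ minFace C b) : x + y ∈ minFace C b := by
  obtain ⟨hxC, t, ht, h1⟩ := hx
  obtain ⟨hyC, s, hs, h2⟩ := hy
  refine ⟨hadd _ hxC _ hyC, min t s / 2, by positivity, ?_⟩
  have h1' := minFace_shrink hadd hsmul hxC h1 (min_le_left t s)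
  have h2' := minFace_shrink hadd hsmul hyC h2 (min_le_right t s)
  have := hsmul _ (hadd _ h1' _ h2') (1/2) (by norm_num)
  convert this using 1
  module

theorem minFace_smul {b x : EuclideanSpace ℝ (Fin d)}
    (hadd : ∀ x ∈ C, ∀ y ∈ C, x + y ∈ C) (hsmul : ∀ x ∈ C, ∀ r : ℝ, 0 ≤ r → r • x ∈ C)
    (hx : x ∈ minFace C b) {r : ℝ} (hr : 0 ≤ r) : r • x ∈ minFace C b := by
  obtain ⟨hxC, t, ht, h1⟩ := hx
  refine ⟨hsmul _ hxC _ hr, t / (r + 1), by positivity, ?_⟩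
  rw [smul_smul]
  refine minFace_shrink hadd hsmul hxC h1 ?_
  rw [div_mul_eq_mul_div, div_le_iff₀ (by positivity)]
  nlinarith

theorem minFace_self {b : EuclideanSpace ℝ (Fin d)}
    (hsmul : ∀ x ∈ C, ∀ r : ℝ, 0 ≤ r → r • x ∈ C) (hb : b ∈ C) : b ∈ minFace C b :=
  ⟨hb, 1, one_pos, by simpa using hsmul b hb 0 le_rfl⟩

theorem minFace_span {b u : EuclideanSpace ℝ (Fin d)}
    (hadd : ∀ x ∈ C, ∀ y ∈ C, x + y ∈ C) (hsmul : ∀ x ∈ C, ∀ r : ℝ, 0 ≤ r → r • x ∈ C)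
    (hb : b ∈ C) (hu : u ∈ Submodule.span ℝ (minFace C b)) :
    ∃ f ∈ minFace C b, ∃ g ∈ minFace C b, u = f - g := by
  have hself := minFace_self hsmul hb
  have hz : (0 : EuclideanSpace ℝ (Fin d)) ∈ minFace C b := by
    simpa using minFace_smul hadd hsmul hself (le_refl (0 : ℝ))
  induction hu using Submodule.span_induction with
  | mem x hx => exact ⟨x, hx, 0, hz, by simp⟩
  | zero => exact ⟨0, hz, 0, hz, by simp⟩
  | add x y _ _ hx hy =>
    obtain ⟨f, hf, g, hg, rfl⟩ := hx
    obtain ⟨f', hf', g', hg', rfl⟩ := hy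
    exact ⟨f + f', minFace_add hadd hsmul hf hf', g + g', minFace_add hadd hsmul hg hg', by abel⟩
  | smul a x _ hx =>
    obtain ⟨f, hf, g, hg, rfl⟩ := hx
    rcases le_total 0 a with ha | ha
    · exact ⟨a • f, minFace_smul hadd hsmul hf ha, a • g, minFace_smul hadd hsmul hg ha,
        by module⟩
    · exact ⟨(-a) • g, minFace_smul hadd hsmul hg (by linarith), (-a) • f,
        minFace_smul hadd hsmul hf (by linarith), by module⟩

theorem minFace_move {b u : EuclideanSpace ℝ (Fin d)}
    (hadd : ∀ x ∈ C, ∀ y ∈ C, x + y ∈ C) (hsmul : ∀ x ∈ C, ∀ r : ℝ, 0 ≤ r → r • x ∈ C)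
    (hb : b ∈ C) (hu : u ∈ Submodule.span ℝ (minFace C b)) :
    ∃ t : ℝ, 0 < t ∧ b - t • u ∈ C := by
  obtain ⟨f, hf, g, hg, rfl⟩ := minFace_span hadd hsmul hb hu
  obtain ⟨hfC, t, ht, h1⟩ := hf
  refine ⟨t, ht, ?_⟩
  have := hadd _ h1 _ (hsmul _ hg.1 t ht.le)
  convert this using 1
  module

theorem minFace_isConeFace {b : EuclideanSpace ℝ (Fin d)} (hcl : IsClosed C)
    (hadd : ∀ x ∈ C, ∀ y ∈ C, x + y ∈ C) (hsmul : ∀ x ∈ C, ∀ r : ℝ, 0 ≤ r → r • x ∈ C)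
    (hb : b ∈ C) : IsConeFace C (minFace C b) := by
  refine ⟨⟨b, minFace_self hsmul hb⟩, ?_, ?_, ?_, ?_⟩
  · have : minFace C b = C ∩ (Submodule.span ℝ (minFace C b) : Set (EuclideanSpace ℝ (Fin d))) := by
      ext x
      constructor
      · intro hx
        exact ⟨hx.1, Submodule.subset_span hx⟩
      · rintro ⟨hx, hs⟩
        exact ⟨hx, minFace_move hadd hsmul hb hs⟩
    rw [this]
    exact hcl.inter (Submodule.closed_of_finiteDimensional _)
  · intro x hx y hy a c ha hc _
    exact minFace_add hadd hsmul (minFace_smul hadd hsmul hx ha) (minFace_smul hadd hsmul hy hc)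
  · exact fun x hx => hx.1
  · rintro x hx y hy z ⟨hz, t, ht, h⟩ ⟨a, c, ha, hc, hac, rfl⟩
    refine ⟨hx, t * a, by positivity, ?_⟩
    have := hadd _ h _ (hsmul _ hy (t * c) (by positivity))
    convert this using 1
    module

theorem minFace_subset {b : EuclideanSpace ℝ (Fin d)} {F : Set (EuclideanSpace ℝ (Fin d))}
    (hadd : ∀ x ∈ C, ∀ y ∈ C, x + y ∈ C) (hsmul : ∀ x ∈ C, ∀ r : ℝ, 0 ≤ r → r • x ∈ C)
    (hF : IsConeFace C F) (hbF : b ∈ F) : minFace C b ⊆ F := by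
  rintro x ⟨hx, t, ht, h⟩
  have h' := minFace_shrink hadd hsmul hx h (min_le_left t (1/2))
  set s := min t (1/2) with hs
  have hs0 : 0 < s := by positivity
  have hs1 : s < 1 := lt_of_le_of_lt (min_le_right _ _) (by norm_num)
  have hs2 : 1 - s ≠ 0 := by linarith
  refine hF.2.2.2.left_mem_of_mem_openSegment hx
    (hsmul _ h' (1 - s)⁻¹ (inv_nonneg.2 (by linarith))) hbF
    ⟨s, 1 - s, hs0, by linarith, by ring, ?_⟩
  rw [smul_smul, mul_inv_cancel₀ hs2]
  module

theorem recession {b u : EuclideanSpace ℝ (Fin d)} (hcl : IsClosed C)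
    (hadd : ∀ x ∈ C, ∀ y ∈ C, x + y ∈ C) (hsmul : ∀ x ∈ C, ∀ r : ℝ, 0 ≤ r → r • x ∈ C)
    (hb : b ∈ C) (h : ¬ BddAbove {t : ℝ | 0 ≤ t ∧ b + t • u ∈ C}) : u ∈ C := by
  have key : ∀ n : ℕ, u + ((1 : ℝ) / ((n : ℝ) + 1)) • b ∈ C := by
    intro n
    obtain ⟨t, ⟨ht0, ht⟩, hnt⟩ := not_bddAbove_iff.1 h ((n : ℝ) + 1)
    have hn : (0 : ℝ) < (n : ℝ) + 1 := by positivity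
    have ht1 : 0 < t := by linarith
    have h1 := hsmul _ ht t⁻¹ (by positivity)
    have h2 : (1 : ℝ) / ((n : ℝ) + 1) - t⁻¹ ≥ 0 := by
      rw [one_div, ge_iff_le, sub_nonneg]
      exact inv_anti₀ hn hnt.le
    have h3 := hadd _ h1 _ (hsmul _ hb _ h2)
    convert h3 using 1
    rw [smul_add, smul_smul, inv_mul_cancel₀ ht1.ne']
    module
  refine hcl.mem_of_tendsto (b := Filter.atTop) ?_ (Filter.Eventually.of_forall key)
  have := ((tendsto_one_div_add_atTop_nhds_zero_nat (𝕜 := ℝ)).smul_const b).const_add u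
  simpa using this

theorem descend {b u : EuclideanSpace ℝ (Fin d)} (hcl : IsClosed C)
    (hadd : ∀ x ∈ C, ∀ y ∈ C, x + y ∈ C) (hsmul : ∀ x ∈ C, ∀ r : ℝ, 0 ≤ r → r • x ∈ C)
    (hb : b ∈ C) (hu : u ∈ Submodule.span ℝ (minFace C b))
    (hbdd : BddAbove {t : ℝ | 0 ≤ t ∧ b + t • u ∈ C}) :
    ∃ t : ℝ, b + t • u ∈ minFace C b ∧
      Module.finrank ℝ (Submodule.span ℝ (minFace C (b + t • u))) <
        Module.finrank ℝ (Submodule.span ℝ (minFace C b)) := by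
  set T := {t : ℝ | 0 ≤ t ∧ b + t • u ∈ C} with hT
  have hTcl : IsClosed T :=
    isClosed_Ici.inter (hcl.preimage (by fun_prop : Continuous fun t : ℝ => b + t • u))
  have hTne : T.Nonempty := ⟨0, le_rfl, by simpa using hb⟩
  obtain ⟨h0, hmem⟩ : sSup T ∈ T := hTcl.csSup_mem hTne hbdd
  set t := sSup T with ht
  have hspan : b + t • u ∈ Submodule.span ℝ (minFace C b) :=
    Submodule.add_mem _ (Submodule.subset_span (minFace_self hsmul hb)) (Submodule.smul_mem _ _ hu)
  have hbt : b + t • u ∈ minFace C b := ⟨hmem, minFace_move hadd hsmul hb hspan⟩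
  refine ⟨t, hbt, Submodule.finrank_lt_finrank_of_lt (lt_of_le_of_ne ?_ ?_)⟩
  · exact Submodule.span_mono
      (minFace_subset hadd hsmul (minFace_isConeFace hcl hadd hsmul hb) hbt)
  · intro heq
    have hu' : -u ∈ Submodule.span ℝ (minFace C (b + t • u)) := by
      rw [heq]; exact Submodule.neg_mem _ hu
    obtain ⟨e, he, h⟩ := minFace_move hadd hsmul hmem hu'
    have : t + e ∈ T := ⟨by linarith, by convert h using 1; module⟩
    have := le_csSup hbdd this
    linarith

theorem main_aux (hcl : IsClosed C)
    (hadd : ∀ x ∈ C, ∀ y ∈ C, x + y ∈ C) (hsmul : ∀ x ∈ C, ∀ r : ℝ, 0 ≤ r → r • x ∈ C)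
    (hpointed : C ∩ (-C) = {0})
    (A : AffineSubspace ℝ (EuclideanSpace ℝ (Fin d)))
    (hA0 : (0 : EuclideanSpace ℝ (Fin d)) ∉ (A : Set (EuclideanSpace ℝ (Fin d))))
    (n : ℕ) : ∀ (b : EuclideanSpace ℝ (Fin d)) (F₀ : Set (EuclideanSpace ℝ (Fin d))),
      IsConeFace C F₀ →
      b ∈ C ∩ (A : Set (EuclideanSpace ℝ (Fin d))) → b ∈ F₀ →
      Module.finrank ℝ (Submodule.span ℝ (minFace C b)) = n →
      ∃ F : Set (EuclideanSpace ℝ (Fin d)), IsConeFace C F ∧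
        ((A : Set (EuclideanSpace ℝ (Fin d))) ∩ F).Nonempty ∧
        1 ≤ Module.finrank ℝ (Submodule.span ℝ F) ∧
        Module.finrank ℝ (Submodule.span ℝ F) ≤ d - Module.finrank ℝ A.direction ∧
        F ⊆ F₀ := by
  induction n using Nat.strong_induction_on with
  | _ n ih =>
  rintro b F₀ hF₀ ⟨hb, hbA⟩ hbF hn
  by_cases hdis : Disjoint (Submodule.span ℝ (minFace C b)) A.direction
  · have hself := minFace_self hsmul hb
    refine ⟨minFace C b, minFace_isConeFace hcl hadd hsmul hb, ⟨b, hbA, hself⟩, ?_, ?_,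
      minFace_subset hadd hsmul hF₀ hbF⟩
    · rw [Nat.one_le_iff_ne_zero]
      intro h
      rw [Submodule.finrank_eq_zero] at h
      have : b ∈ (⊥ : Submodule ℝ (EuclideanSpace ℝ (Fin d))) := h ▸ Submodule.subset_span hself
      rw [Submodule.mem_bot] at this
      exact hA0 (this ▸ hbA)
    · have := Submodule.finrank_add_finrank_le_of_disjoint hdis
      rw [finrank_euclideanSpace_fin] at this
      omega
  · rw [Submodule.disjoint_def] at hdis
    push Not at hdis
    obtain ⟨u, hu, huA, hu0⟩ := hdis
    have hstep : ∀ w ∈ Submodule.span ℝ (minFace C b), w ∈ A.direction →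
        BddAbove {t : ℝ | 0 ≤ t ∧ b + t • w ∈ C} →
        ∃ F : Set (EuclideanSpace ℝ (Fin d)), IsConeFace C F ∧
          ((A : Set (EuclideanSpace ℝ (Fin d))) ∩ F).Nonempty ∧
          1 ≤ Module.finrank ℝ (Submodule.span ℝ F) ∧
          Module.finrank ℝ (Submodule.span ℝ F) ≤ d - Module.finrank ℝ A.direction ∧
          F ⊆ F₀ := by
      intro w hw hwA hbdd
      obtain ⟨t, hbt, hlt⟩ := descend hcl hadd hsmul hb hw hbdd
      refine ih _ (hn ▸ hlt) (b + t • w) F₀ hF₀ ⟨hbt.1, ?_⟩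
        (minFace_subset hadd hsmul hF₀ hbF hbt) rfl
      have := AffineSubspace.vadd_mem_of_mem_direction (A.direction.smul_mem t hwA) hbA
      rwa [vadd_eq_add, add_comm] at this
    by_cases h1 : BddAbove {t : ℝ | 0 ≤ t ∧ b + t • u ∈ C}
    · exact hstep u hu huA h1
    by_cases h2 : BddAbove {t : ℝ | 0 ≤ t ∧ b + t • (-u) ∈ C}
    · exact hstep (-u) (Submodule.neg_mem _ hu) (Submodule.neg_mem _ huA) h2
    have hmem : u ∈ C ∩ (-C) := ⟨recession hcl hadd hsmul hb h1,
      Set.mem_neg.2 (recession hcl hadd hsmul hb h2)⟩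
    rw [hpointed] at hmem
    exact absurd hmem hu0

end

theorem stmt15 {d : ℕ} (V : Finset (EuclideanSpace ℝ (Fin d)))
    (C : Set (EuclideanSpace ℝ (Fin d)))
    (hC : C = {x | ∃ c : EuclideanSpace ℝ (Fin d) → ℝ,
      (∀ v, 0 ≤ c v) ∧ x = ∑ v ∈ V, c v • v})
    (hpointed : C ∩ (-C) = {0})
    (hspan : Submodule.span ℝ C = ⊤)
    (A : AffineSubspace ℝ (EuclideanSpace ℝ (Fin d)))
    (hA0 : (0 : EuclideanSpace ℝ (Fin d)) ∉ (A : Set (EuclideanSpace ℝ (Fin d))))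
    (hAC : ((A : Set (EuclideanSpace ℝ (Fin d))) ∩ C).Nonempty) :
    (∃ F : Set (EuclideanSpace ℝ (Fin d)), IsConeFace C F ∧
      ((A : Set (EuclideanSpace ℝ (Fin d))) ∩ F).Nonempty ∧
      1 ≤ Module.finrank ℝ (Submodule.span ℝ F) ∧
      Module.finrank ℝ (Submodule.span ℝ F) ≤ d - Module.finrank ℝ A.direction) ∧
    (∀ (b₀ : EuclideanSpace ℝ (Fin d)) (F₀ : Set (EuclideanSpace ℝ (Fin d))),
      IsConeFace C F₀ →
      b₀ ∈ C ∩ (A : Set (EuclideanSpace ℝ (Fin d))) → b₀ ∈ F₀ →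
      ∃ F : Set (EuclideanSpace ℝ (Fin d)), IsConeFace C F ∧
        ((A : Set (EuclideanSpace ℝ (Fin d))) ∩ F).Nonempty ∧
        1 ≤ Module.finrank ℝ (Submodule.span ℝ F) ∧
        Module.finrank ℝ (Submodule.span ℝ F) ≤ d - Module.finrank ℝ A.direction ∧
        F ⊆ F₀) := by
  have hcl := cone_isClosed V C hC hpointed
  have hadd : ∀ x ∈ C, ∀ y ∈ C, x + y ∈ C := by
    rw [hC]
    rintro x ⟨c, hc, rfl⟩ y ⟨c', hc', rfl⟩
    exact ⟨fun v => c v + c' v, fun v => add_nonneg (hc v) (hc' v),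
      by simp only [add_smul, Finset.sum_add_distrib]⟩
  have hsmul : ∀ x ∈ C, ∀ r : ℝ, 0 ≤ r → r • x ∈ C := by
    rw [hC]
    rintro x ⟨c, hc, rfl⟩ r hr
    exact ⟨fun v => r * c v, fun v => mul_nonneg hr (hc v),
      by simp only [mul_smul, Finset.smul_sum]⟩
  have main := fun b F₀ h1 h2 h3 =>
    main_aux hcl hadd hsmul hpointed A hA0 _ b F₀ h1 h2 h3 rfl
  refine ⟨?_, main⟩
  obtain ⟨b, hbA, hbC⟩ := hAC
  have hface : IsConeFace C C := by
    refine ⟨⟨b, hbC⟩, hcl, ?_, subset_rfl, fun x hx _ _ _ _ _ => hx⟩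
    intro x hx y hy a c ha hc _
    exact hadd _ (hsmul _ hx _ ha) _ (hsmul _ hy _ hc)
  obtain ⟨F, h1, h2, h3, h4, _⟩ := main b C hface ⟨hbC, hbA⟩ hbC
  exact ⟨F, h1, h2, h3, h4⟩
end
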